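/- arXiv:1211.1309 — 2 statements merged into one kernel-verified Lean document; each statement's English description precedes it below -/
import Mathlib

section
/- Let p, s, r be integers with 1 ≤ r ≤ s ≤ p, and suppose the observed n×p matrix X has rows i.i.d. N(0,Σ) with Σ ∈ Θ₀(s,p,r,λ) (noise variance σ² = 1). Then there exists an absolute constant c > 0 such that inf_{V̂} sup_{Σ ∈ Θ₀(s,p,r,λ)} E‖V̂V̂' − VV'‖_F² ≥ c·( [ (1/(n·h(λ)))·( r(s−r) + (s−r)·log(e(p−r)/(s−r)) ) ] ∧ 1 ), where the infimum is over all estimators V̂ = V̂(X) with values in O(p,r) (and the term (s−r)·log(e(p−r)/(s−r)) is read as 0 when s = r). -/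
open MeasureTheory ProbabilityTheory Matrix Real
open scoped BigOperators ENNReal NNReal

noncomputable section

namespace SparsePCA

/-- The measure on `ι → ℝ` with i.i.d. standard normal coordinates. -/
def stdGaussian (ι : Type*) [Fintype ι] : Measure (ι → ℝ) :=
  Measure.pi fun _ => gaussianReal 0 1

/-- The measure on `Fin n → Fin m → ℝ` whose entries are i.i.d. standard normal. -/
def gaussianMatrix (n m : ℕ) : Measure (Fin n → Fin m → ℝ) :=
  Measure.pi fun _ => stdGaussian (Fin m)

/-- `V` has orthonormal columns, i.e. `V ∈ O(p,r)`. -/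
def IsOrthonormalCols {p r : ℕ} (V : Matrix (Fin p) (Fin r) ℝ) : Prop :=
  Vᵀ * V = 1

/-- Squared Frobenius norm. -/
def frobSq {m k : Type*} [Fintype m] [Fintype k] (A : Matrix m k ℝ) : ℝ :=
  ∑ i, ∑ j, (A i j) ^ 2

/-- Subspace estimation loss `‖V Vᵀ - W Wᵀ‖_F²`. -/
def loss {p r : ℕ} (V W : Matrix (Fin p) (Fin r) ℝ) : ℝ :=
  frobSq (V * Vᵀ - W * Wᵀ)

/-- Euclidean norm of row `j` of `V`. -/
def rowNorm {p r : ℕ} (V : Matrix (Fin p) (Fin r) ℝ) (j : Fin p) : ℝ :=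
  Real.sqrt (∑ i, (V j i) ^ 2)

/-- The `j`-th largest row norm of `V` (zero-based: `j = 0` is the largest). -/
def sortedRowNorm {p r : ℕ} (V : Matrix (Fin p) (Fin r) ℝ) (j : Fin p) : ℝ :=
  rowNorm V ((Tuple.sort (fun i => - rowNorm V i)) j)

/-- Weak `ℓ_q` radius `‖V‖_{q,w} = max_j j ‖V_{(j)*}‖^q`, with the convention
`0 ^ q = 0` (so that for `q = 0` this is the number of nonzero rows). -/
def weakLq {p r : ℕ} (q : ℝ) (V : Matrix (Fin p) (Fin r) ℝ) : ℝ :=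
  ⨆ j : Fin p, ((j : ℕ) + 1 : ℝ) *
    (if sortedRowNorm V j = 0 then 0 else (sortedRowNorm V j) ^ q)

/-- `h(λ) = λ² / (λ + 1)`. -/
def hfun (lam : ℝ) : ℝ := lam ^ 2 / (lam + 1)

/-- The rate function `Ψ(k,p,r,n,λ)`. -/
def Psi (k p r n : ℕ) (lam : ℝ) : ℝ :=
  ((r : ℝ) * k + k * Real.log (Real.exp 1 * p / k)) / (n * hfun lam)

/-- The rate function `Ψ₀(k,p,r,n,λ)`. -/
def Psi0 (k p r n : ℕ) (lam : ℝ) : ℝ :=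
  ((r : ℝ) * ((k : ℝ) - r) + k * Real.log (Real.exp 1 * p / k)) / (n * hfun lam)

/-- `x_q(s,p,r,n,λ)`. -/
def xq (q s : ℝ) (p r n : ℕ) (lam : ℝ) : ℝ :=
  sSup {x : ℝ | 0 ≤ x ∧ x ≤ p ∧
    x ≤ s * (n * hfun lam / ((r : ℝ) + Real.log (Real.exp 1 * p / x))) ^ (q / 2)}

/-- Effective dimension `k*_q = ⌈x_q⌉`. -/
def kq (q s : ℝ) (p r n : ℕ) (lam : ℝ) : ℕ := ⌈xq q s p r n lam⌉₊

/-- Membership of `Σ = V Λ Vᵀ + I` in `Θ_q(s,p,r,λ)` with constant `κ`,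
phrased in terms of the pair `(V, Λ)`. -/
def InTheta (q s : ℝ) (p r : ℕ) (lam κ : ℝ)
    (V : Matrix (Fin p) (Fin r) ℝ) (Λ : Fin r → ℝ) : Prop :=
  IsOrthonormalCols V ∧ weakLq q V ≤ s ∧ Antitone Λ ∧
    (∀ i, 0 < lam ∧ lam ≤ Λ i ∧ Λ i ≤ κ * lam)

/-- The distribution of the data matrix `X = U D Vᵀ + σ Z` (rows i.i.d.
`N(0, V Λ Vᵀ + σ² I_p)`), as a measure on `Fin n → Fin p → ℝ`. -/
def spikedMeasure (n p r : ℕ) (Λ : Fin r → ℝ) (V : Matrix (Fin p) (Fin r) ℝ)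
    (σ2 : ℝ) : Measure (Fin n → Fin p → ℝ) :=
  Measure.map
    (fun w : (Fin n → Fin r → ℝ) × (Fin n → Fin p → ℝ) =>
      fun i j => (∑ k, w.1 i k * Real.sqrt (Λ k) * V j k) + Real.sqrt σ2 * w.2 i j)
    ((gaussianMatrix n r).prod (gaussianMatrix n p))


/-- The minimax risk for estimating the principal subspace over
`Θ_q(s,p,r,λ)` (noise variance `1`), where the infimum runs over all
measurable estimators with values in `O(p,r)`. -/
def minimaxRisk (q : ℝ) (n p r : ℕ) (s lam κ : ℝ) : ℝ :=
  ⨅ est : {f : (Fin n → Fin p → ℝ) → (Fin p → Fin r → ℝ) //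
      Measurable f ∧ ∀ x, IsOrthonormalCols (Matrix.of (f x))},
    ⨆ (V : Matrix (Fin p) (Fin r) ℝ) (Λ : Fin r → ℝ)
      (_ : InTheta q s p r lam κ V Λ),
      ∫ x, loss (Matrix.of (est.1 x)) V ∂ spikedMeasure n p r Λ V 1

/-! ### Gaussian product measures and their densities -/

instance instProbStdGaussian (ι : Type*) [Fintype ι] : IsProbabilityMeasure (stdGaussian ι) := by
  unfold stdGaussian; infer_instance

instance instProbGaussianMatrix (n m : ℕ) : IsProbabilityMeasure (gaussianMatrix n m) := by
  unfold gaussianMatrix; infer_instance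

lemma lintegral_pi_prod_ofReal {ι : Type*} [Fintype ι] {E : ι → Type*}
    [∀ i, MeasurableSpace (E i)] (μ : ∀ i, Measure (E i)) [∀ i, SigmaFinite (μ i)]
    (f : ∀ i, E i → ℝ) (hf : ∀ i, Integrable (f i) (μ i)) (h0 : ∀ i x, 0 ≤ f i x) :
    ∫⁻ x, ENNReal.ofReal (∏ i, f i (x i)) ∂(Measure.pi μ)
      = ∏ i, ∫⁻ x, ENNReal.ofReal (f i x) ∂(μ i) := by
  rw [← ofReal_integral_eq_lintegral_ofReal (Integrable.fintype_prod_dep hf)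
    (Filter.Eventually.of_forall fun x => Finset.prod_nonneg fun i _ => h0 i _)]
  rw [integral_fintype_prod_eq_prod]
  rw [ENNReal.ofReal_prod_of_nonneg (fun i _ => integral_nonneg (h0 i))]
  refine Finset.prod_congr rfl fun i _ => ?_
  exact ofReal_integral_eq_lintegral_ofReal (hf i) (Filter.Eventually.of_forall (h0 i))

lemma pi_withDensity_ofReal {ι : Type*} [Fintype ι] {E : ι → Type*}
    [∀ i, MeasurableSpace (E i)] (μ : ∀ i, Measure (E i)) [∀ i, IsProbabilityMeasure (μ i)]
    (f : ∀ i, E i → ℝ) (hf : ∀ i, Integrable (f i) (μ i)) (h0 : ∀ i x, 0 ≤ f i x) :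
    Measure.pi (fun i => (μ i).withDensity fun x => ENNReal.ofReal (f i x))
      = (Measure.pi μ).withDensity fun x => ENNReal.ofReal (∏ i, f i (x i)) := by
  have hfin : ∀ i, IsFiniteMeasure ((μ i).withDensity fun x => ENNReal.ofReal (f i x)) := by
    intro i
    exact isFiniteMeasure_withDensity_ofReal (hf i).2
  refine Measure.pi_eq fun s hs => ?_
  rw [withDensity_apply _ (MeasurableSet.univ_pi hs), ← lintegral_indicator (MeasurableSet.univ_pi hs)]
  have : ∀ x : (∀ i, E i), (Set.univ.pi s).indicator (fun x => ENNReal.ofReal (∏ i, f i (x i))) x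
      = ENNReal.ofReal (∏ i, (s i).indicator (f i) (x i)) := by
    intro x
    by_cases hx : x ∈ Set.univ.pi s
    · rw [Set.indicator_of_mem hx]
      congr 1
      refine Finset.prod_congr rfl fun i _ => ?_
      rw [Set.indicator_of_mem (hx i trivial)]
    · rw [Set.indicator_of_notMem hx]
      have : ∃ i, x i ∉ s i := by
        by_contra! h
        exact hx fun i _ => h i
      obtain ⟨i, hi⟩ := this
      rw [Finset.prod_eq_zero (Finset.mem_univ i) (Set.indicator_of_notMem hi _)]
      simp
  simp_rw [this]
  rw [lintegral_pi_prod_ofReal μ (fun i => (s i).indicator (f i)) (fun i => (hf i).indicator (hs i))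
    (fun i x => Set.indicator_nonneg (fun x _ => h0 i x) x)]
  refine Finset.prod_congr rfl fun i _ => ?_
  rw [withDensity_apply _ (hs i), ← lintegral_indicator (hs i)]
  refine lintegral_congr fun x => ?_
  by_cases hx : x ∈ s i
  · simp [hx]
  · simp [hx]

lemma gaussian_shift (c : ℝ) :
    (gaussianReal 0 1).map (fun x => c + x)
      = (gaussianReal 0 1).withDensity fun x => ENNReal.ofReal (Real.exp (c * x - c ^ 2 / 2)) := by
  rw [gaussianReal_map_const_add, gaussianReal_of_var_ne_zero _ one_ne_zero,
    gaussianReal_of_var_ne_zero _ one_ne_zero,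
    ← withDensity_mul _ (measurable_gaussianPDF 0 1) (by fun_prop)]
  congr 1
  ext x
  simp only [Pi.mul_apply, gaussianPDF, gaussianPDFReal]
  rw [← ENNReal.ofReal_mul (by positivity), mul_assoc (Real.sqrt _)⁻¹, ← Real.exp_add]
  congr 3
  simp
  ring

lemma integrable_of_map_eq {E : Type*} [MeasurableSpace E] (μ ν : Measure E)
    [IsFiniteMeasure ν] (f : E → ℝ) (hf : Measurable f) (h0 : ∀ x, 0 ≤ f x)
    (h : ν = μ.withDensity fun x => ENNReal.ofReal (f x)) : Integrable f μ := by
  refine ⟨hf.aestronglyMeasurable, ?_⟩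
  rw [hasFiniteIntegral_iff_ofReal (Filter.Eventually.of_forall h0)]
  have := measure_lt_top ν Set.univ
  rw [h, withDensity_apply _ MeasurableSet.univ] at this
  simpa using this

lemma stdGaussian_shift {ι : Type*} [Fintype ι] (c : ι → ℝ) :
    (stdGaussian ι).map (fun x j => c j + x j)
      = (stdGaussian ι).withDensity fun x =>
        ENNReal.ofReal (∏ j, Real.exp (c j * x j - c j ^ 2 / 2)) := by
  have hprob : ∀ j, IsProbabilityMeasure ((gaussianReal 0 1).map (fun x => c j + x)) := fun j =>
    Measure.isProbabilityMeasure_map (by fun_prop)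
  unfold stdGaussian
  rw [← pi_withDensity_ofReal (fun _ : ι => gaussianReal 0 1)
    (fun j x => Real.exp (c j * x - c j ^ 2 / 2))]
  · rw [Measure.pi_map_pi (μ := fun _ : ι => gaussianReal 0 1) (f := fun j x => c j + x)]
    · simp_rw [gaussian_shift]
    · intro i; fun_prop
  · intro j
    exact integrable_of_map_eq _ _ _ (by fun_prop) (fun x => (Real.exp_pos _).le) (gaussian_shift (c j))
  · intro j x; positivity

lemma gaussianMatrix_shift {n m : ℕ} (c : Fin n → Fin m → ℝ) :
    (gaussianMatrix n m).map (fun x i j => c i j + x i j)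
      = (gaussianMatrix n m).withDensity fun x =>
        ENNReal.ofReal (∏ i, ∏ j, Real.exp (c i j * x i j - c i j ^ 2 / 2)) := by
  have hprob : ∀ i, IsProbabilityMeasure ((stdGaussian (Fin m)).map (fun x j => c i j + x j)) :=
    fun i => Measure.isProbabilityMeasure_map (Measurable.aemeasurable (by fun_prop))
  unfold gaussianMatrix
  rw [← pi_withDensity_ofReal (fun _ : Fin n => stdGaussian (Fin m))
    (fun i x => ∏ j, Real.exp (c i j * x j - c i j ^ 2 / 2))]
  · rw [Measure.pi_map_pi (μ := fun _ : Fin n => stdGaussian (Fin m)) (f := fun i x j => c i j + x j)]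
    · simp_rw [stdGaussian_shift]
    · exact fun i => Measurable.aemeasurable (by fun_prop)
  · intro i
    exact integrable_of_map_eq _ _ _ (by fun_prop) (fun x => by positivity) (stdGaussian_shift (c i))
  · intro j x; positivity

lemma gaussian_mgf_quad (a l : ℝ) (hl : 0 < l) :
    ∫⁻ u, ENNReal.ofReal (Real.exp (a * u - l * u ^ 2 / 2)) ∂(gaussianReal 0 1)
      = ENNReal.ofReal ((Real.sqrt (1 + l))⁻¹ * Real.exp (a ^ 2 / (2 * (1 + l)))) := by
  rw [gaussianReal_of_var_ne_zero _ one_ne_zero,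
    lintegral_withDensity_eq_lintegral_mul _ (measurable_gaussianPDF 0 1) (by fun_prop)]
  set v : ℝ≥0 := ⟨(1 + l)⁻¹, by positivity⟩ with hv
  have hvv : (v : ℝ) = (1 + l)⁻¹ := rfl
  have hv0 : v ≠ 0 := by
    intro h
    have : (v : ℝ) = 0 := by rw [h]; rfl
    rw [hvv] at this
    have : 0 < (1 + l)⁻¹ := by positivity
    linarith
  have key : ∀ u : ℝ, (gaussianPDF 0 1 * fun u => ENNReal.ofReal (Real.exp (a * u - l * u ^ 2 / 2))) u
      = ENNReal.ofReal ((Real.sqrt (1 + l))⁻¹ * Real.exp (a ^ 2 / (2 * (1 + l))))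
        * gaussianPDF (a / (1 + l)) v u := by
    intro u
    simp only [Pi.mul_apply, gaussianPDF, gaussianPDFReal]
    rw [← ENNReal.ofReal_mul (by positivity), ← ENNReal.ofReal_mul (by positivity)]
    congr 1
    rw [hvv, NNReal.coe_one]
    have h1 : Real.sqrt (2 * π * (1 + l)⁻¹) = Real.sqrt (2 * π * 1) * (Real.sqrt (1 + l))⁻¹ := by
      rw [Real.sqrt_mul (by positivity), Real.sqrt_inv, mul_one]
    rw [h1]
    have h2 : Real.exp (-(u - 0) ^ 2 / (2 * 1)) * Real.exp (a * u - l * u ^ 2 / 2)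
        = Real.exp (a ^ 2 / (2 * (1 + l))) * Real.exp (-(u - a / (1 + l)) ^ 2 / (2 * (1 + l)⁻¹)) := by
      rw [← Real.exp_add, ← Real.exp_add]
      congr 1
      field_simp
      ring
    rw [mul_assoc, h2]
    have h3 : Real.sqrt (1 + l) ≠ 0 := by positivity
    have h4 : Real.sqrt (2 * π * 1) ≠ 0 := by positivity
    field_simp
  rw [lintegral_congr key, lintegral_const_mul _ (measurable_gaussianPDF _ _),
    lintegral_gaussianPDF_eq_one _ hv0, mul_one]

lemma integrable_exp_quad (a l : ℝ) (hl : 0 < l) :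
    Integrable (fun u => Real.exp (a * u - l * u ^ 2 / 2)) (gaussianReal 0 1) := by
  refine ⟨Measurable.aestronglyMeasurable (by fun_prop), ?_⟩
  rw [hasFiniteIntegral_iff_ofReal (Filter.Eventually.of_forall fun x => (Real.exp_pos _).le),
    gaussian_mgf_quad a l hl]
  exact ENNReal.ofReal_lt_top

lemma stdGaussian_quad {m : ℕ} (a : Fin m → ℝ) (l : ℝ) (hl : 0 < l) :
    ∫⁻ u, ENNReal.ofReal (∏ k, Real.exp (a k * u k - l * u k ^ 2 / 2)) ∂(stdGaussian (Fin m))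
      = ENNReal.ofReal (∏ k, ((Real.sqrt (1 + l))⁻¹ * Real.exp (a k ^ 2 / (2 * (1 + l))))) := by
  unfold stdGaussian
  rw [lintegral_pi_prod_ofReal (fun _ : Fin m => gaussianReal 0 1)
    (fun k u => Real.exp (a k * u - l * u ^ 2 / 2))
    (fun k => integrable_exp_quad _ _ hl) (fun k x => (Real.exp_pos _).le)]
  simp_rw [gaussian_mgf_quad _ l hl]
  rw [ENNReal.ofReal_prod_of_nonneg (fun i _ => by positivity)]

lemma gaussianMatrix_quad {n m : ℕ} (a : Fin n → Fin m → ℝ) (l : ℝ) (hl : 0 < l) :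
    ∫⁻ u, ENNReal.ofReal (∏ i, ∏ k, Real.exp (a i k * u i k - l * u i k ^ 2 / 2))
        ∂(gaussianMatrix n m)
      = ENNReal.ofReal
        (∏ i, ∏ k, ((Real.sqrt (1 + l))⁻¹ * Real.exp (a i k ^ 2 / (2 * (1 + l))))) := by
  unfold gaussianMatrix
  rw [lintegral_pi_prod_ofReal (fun _ : Fin n => stdGaussian (Fin m))
    (fun i u => ∏ k, Real.exp (a i k * u k - l * u k ^ 2 / 2))
    (fun i => ?_) (fun i x => by positivity)]
  · simp_rw [stdGaussian_quad _ l hl]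
    rw [ENNReal.ofReal_prod_of_nonneg (fun i _ => by positivity)]
  · refine ⟨Measurable.aestronglyMeasurable (by fun_prop), ?_⟩
    rw [hasFiniteIntegral_iff_ofReal (Filter.Eventually.of_forall fun x => by positivity),
      stdGaussian_quad _ l hl]
    exact ENNReal.ofReal_lt_top

/-- The quadratic form `∑ᵢ ‖Vᵀ xᵢ‖²`. -/
def quadV {n p r : ℕ} (V : Matrix (Fin p) (Fin r) ℝ) (x : Fin n → Fin p → ℝ) : ℝ :=
  ∑ i, ∑ k, (∑ j, V j k * x i j) ^ 2

/-- Density of the spiked measure with equal spikes, w.r.t. the standard Gaussian. -/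
def dens {n p r : ℕ} (lam : ℝ) (V : Matrix (Fin p) (Fin r) ℝ) (x : Fin n → Fin p → ℝ) : ℝ :=
  (∏ _i : Fin n, ∏ _k : Fin r, (Real.sqrt (1 + lam))⁻¹) *
    Real.exp (lam / (2 * (1 + lam)) * quadV V x)

lemma orth_norm {p r : ℕ} {V : Matrix (Fin p) (Fin r) ℝ} (hV : IsOrthonormalCols V)
    (u : Fin r → ℝ) : ∑ j, (∑ k, u k * V j k) ^ 2 = ∑ k, u k ^ 2 := by
  have h : ∀ k l, ∑ j, V j k * V j l = if k = l then 1 else 0 := by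
    intro k l
    have := congrFun (congrFun hV k) l
    simpa [Matrix.mul_apply, Matrix.one_apply] using this
  calc ∑ j, (∑ k, u k * V j k) ^ 2
      = ∑ j, ∑ k, ∑ l, u k * u l * (V j k * V j l) := by
        refine Finset.sum_congr rfl fun j _ => ?_
        rw [sq, Finset.sum_mul_sum]
        refine Finset.sum_congr rfl fun k _ => Finset.sum_congr rfl fun l _ => by ring
    _ = ∑ k, ∑ l, u k * u l * ∑ j, V j k * V j l := by
        rw [Finset.sum_comm]
        refine Finset.sum_congr rfl fun k _ => ?_
        rw [Finset.sum_comm]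
        refine Finset.sum_congr rfl fun l _ => ?_
        rw [Finset.mul_sum]
    _ = ∑ k, u k ^ 2 := by
        refine Finset.sum_congr rfl fun k _ => ?_
        simp [h, sq]

lemma measurable_quadV {n p r : ℕ} (V : Matrix (Fin p) (Fin r) ℝ) :
    Measurable (quadV (n := n) V) := by
  unfold quadV; fun_prop

lemma measurable_dens {n p r : ℕ} (lam : ℝ) (V : Matrix (Fin p) (Fin r) ℝ) :
    Measurable (dens (n := n) lam V) := by
  have := measurable_quadV (n := n) V
  unfold dens; fun_prop

lemma dens_pos {n p r : ℕ} (lam : ℝ) (hl : 0 < lam) (V : Matrix (Fin p) (Fin r) ℝ)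
    (x : Fin n → Fin p → ℝ) : 0 < dens lam V x := by
  unfold dens; positivity

lemma spiked_density {n p r : ℕ} (lam : ℝ) (hl : 0 < lam) {V : Matrix (Fin p) (Fin r) ℝ}
    (hV : IsOrthonormalCols V) :
    spikedMeasure n p r (fun _ => lam) V 1
      = (gaussianMatrix n p).withDensity fun x => ENNReal.ofReal (dens lam V x) := by
  ext s hs
  unfold spikedMeasure
  have hmeas : Measurable (fun w : (Fin n → Fin r → ℝ) × (Fin n → Fin p → ℝ) =>
      fun i j => (∑ k, w.1 i k * Real.sqrt lam * V j k) + Real.sqrt 1 * w.2 i j) := by fun_prop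
  rw [Measure.map_apply hmeas hs, Measure.prod_apply (hmeas hs), withDensity_apply _ hs]
  have h1 : ∀ u : Fin n → Fin r → ℝ,
      gaussianMatrix n p (Prod.mk u ⁻¹' ((fun w : (Fin n → Fin r → ℝ) × (Fin n → Fin p → ℝ) =>
      fun i j => (∑ k, w.1 i k * Real.sqrt lam * V j k) + Real.sqrt 1 * w.2 i j) ⁻¹' s))
      = ∫⁻ x in s, ENNReal.ofReal (∏ i, ∏ k,
          Real.exp ((Real.sqrt lam * ∑ j, V j k * x i j) * u i k - lam * u i k ^ 2 / 2))
          ∂(gaussianMatrix n p) := by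
    intro u
    have h2 := DFunLike.congr_fun
      (gaussianMatrix_shift (n := n) (m := p) fun i j => ∑ k, u i k * Real.sqrt lam * V j k) s
    rw [Measure.map_apply (by fun_prop) hs, withDensity_apply _ hs] at h2
    convert h2 using 2
    · ext z; simp
    · ext x
      congr 1
      refine Finset.prod_congr rfl fun i _ => ?_
      rw [← Real.exp_sum, ← Real.exp_sum]
      congr 1
      rw [Finset.sum_sub_distrib, Finset.sum_sub_distrib]
      congr 1
      · simp_rw [Finset.mul_sum, Finset.sum_mul]
        rw [Finset.sum_comm]
        refine Finset.sum_congr rfl fun k _ => Finset.sum_congr rfl fun l _ => by ring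
      · rw [← Finset.sum_div, ← Finset.sum_div]
        congr 1
        have := orth_norm hV (fun k => u i k * Real.sqrt lam)
        rw [this]
        refine Finset.sum_congr rfl fun k _ => ?_
        rw [mul_pow, Real.sq_sqrt hl.le]; ring
  simp_rw [h1]
  rw [lintegral_lintegral_swap (Measurable.aemeasurable (by fun_prop))]
  refine lintegral_congr fun x => ?_
  rw [gaussianMatrix_quad _ lam hl]
  congr 1
  unfold dens quadV
  simp_rw [Finset.prod_mul_distrib, ← Real.exp_sum]
  congr 2
  simp_rw [Finset.mul_sum]
  refine Finset.sum_congr rfl fun i _ => Finset.sum_congr rfl fun k _ => ?_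
  rw [← Finset.mul_sum, mul_pow, Real.sq_sqrt hl.le]
  ring

instance instProbSpiked {n p r : ℕ} (Λ : Fin r → ℝ) (V : Matrix (Fin p) (Fin r) ℝ) (σ2 : ℝ) :
    IsProbabilityMeasure (spikedMeasure n p r Λ V σ2) := by
  unfold spikedMeasure
  exact Measure.isProbabilityMeasure_map (Measurable.aemeasurable (by fun_prop))

/-! ### Second moments and the Kullback-Leibler divergence -/

lemma std_memLp {m : ℕ} (j : Fin m) : MemLp (fun x : Fin m → ℝ => x j) 2 (stdGaussian (Fin m)) := by
  have h := (memLp_id_gaussianReal' (μ := 0) (v := 1) 2 (by simp)).comp_measurePreserving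
    (measurePreserving_eval (fun _ : Fin m => gaussianReal 0 1) j)
  exact h

lemma std_mean {m : ℕ} (j : Fin m) : ∫ x : Fin m → ℝ, x j ∂(stdGaussian (Fin m)) = 0 := by
  unfold stdGaussian
  rw [integral_comp_eval (μ := fun _ : Fin m => gaussianReal 0 1) (i := j) (f := fun x => x)
    (by fun_prop)]
  exact integral_id_gaussianReal

lemma std_second {m : ℕ} (j j' : Fin m) :
    ∫ x : Fin m → ℝ, x j * x j' ∂(stdGaussian (Fin m)) = if j = j' then 1 else 0 := by
  by_cases h : j = j'
  · subst h
    simp only [if_true]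
    unfold stdGaussian
    rw [integral_comp_eval (μ := fun _ : Fin m => gaussianReal 0 1) (i := j) (f := fun x => x * x)
      (by fun_prop)]
    have := variance_of_integral_eq_zero (μ := gaussianReal 0 1) (X := id) (by fun_prop)
      (integral_id_gaussianReal)
    rw [variance_id_gaussianReal] at this
    simp only [id] at this
    simp_rw [← sq]
    rw [← this]; simp
  · rw [if_neg h]
    have hi := (iIndepFun_pi (μ := fun _ : Fin m => gaussianReal 0 1) (X := fun _ x => x)
      (fun _ => by fun_prop)).indepFun h
    have := hi.integral_fun_mul_eq_mul_integral
      (measurable_pi_apply j).aestronglyMeasurable (measurable_pi_apply j').aestronglyMeasurable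
    have h0 := std_mean j
    unfold stdGaussian at *
    rw [this, h0, zero_mul]

lemma gm_memLp {n m : ℕ} (i : Fin n) (j : Fin m) :
    MemLp (fun x : Fin n → Fin m → ℝ => x i j) 2 (gaussianMatrix n m) :=
  (std_memLp j).comp_measurePreserving
    (measurePreserving_eval (fun _ : Fin n => stdGaussian (Fin m)) i)

lemma gm_mean {n m : ℕ} (i : Fin n) (j : Fin m) :
    ∫ x : Fin n → Fin m → ℝ, x i j ∂(gaussianMatrix n m) = 0 := by
  unfold gaussianMatrix
  rw [integral_comp_eval (μ := fun _ : Fin n => stdGaussian (Fin m)) (i := i) (f := fun x => x j)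
    (measurable_pi_apply j).aestronglyMeasurable]
  exact std_mean j

lemma gm_second {n m : ℕ} (i : Fin n) (j j' : Fin m) :
    ∫ x : Fin n → Fin m → ℝ, x i j * x i j' ∂(gaussianMatrix n m) = if j = j' then 1 else 0 := by
  unfold gaussianMatrix
  rw [integral_comp_eval (μ := fun _ : Fin n => stdGaussian (Fin m)) (i := i)
    (f := fun x => x j * x j') (by fun_prop)]
  exact std_second j j'

/-- Second moment of a linear combination of an orthonormal family. -/
lemma orthofamily_sq {Ω K : Type*} [MeasurableSpace Ω] [Fintype K] [DecidableEq K] (μ : Measure Ω)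
    (ξ : K → Ω → ℝ) (h1 : ∀ a b, Integrable (fun w => ξ a w * ξ b w) μ)
    (h2 : ∀ a b, ∫ w, ξ a w * ξ b w ∂μ = if a = b then 1 else 0) (c : K → ℝ) :
    Integrable (fun w => (∑ a, c a * ξ a w) ^ 2) μ ∧
      ∫ w, (∑ a, c a * ξ a w) ^ 2 ∂μ = ∑ a, c a ^ 2 := by
  have he : (fun w => (∑ a, c a * ξ a w) ^ 2) =
      fun w => ∑ a, ∑ b, (c a * c b) * (ξ a w * ξ b w) := by
    ext w
    rw [sq, Finset.sum_mul_sum]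
    exact Finset.sum_congr rfl fun a _ => Finset.sum_congr rfl fun b _ => by ring
  rw [he]
  have hi : ∀ a b, Integrable (fun w => (c a * c b) * (ξ a w * ξ b w)) μ :=
    fun a b => (h1 a b).const_mul _
  refine ⟨integrable_finsetSum _ fun a _ => integrable_finsetSum _ fun b _ => hi a b, ?_⟩
  rw [integral_finsetSum _ fun a _ => integrable_finsetSum _ fun b _ => hi a b]
  refine Finset.sum_congr rfl fun a _ => ?_
  rw [integral_finsetSum _ fun b _ => hi a b]
  simp_rw [integral_const_mul, h2]
  simp [sq]

/-- The coordinates of row `i` of the latent variables. -/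
def latent {n r p : ℕ} (i : Fin n) :
    Fin r ⊕ Fin p → ((Fin n → Fin r → ℝ) × (Fin n → Fin p → ℝ)) → ℝ
  | Sum.inl k => fun w => w.1 i k
  | Sum.inr j => fun w => w.2 i j

lemma latent_ortho {n r p : ℕ} (i : Fin n) (a b : Fin r ⊕ Fin p) :
    Integrable (fun w => latent i a w * latent i b w) ((gaussianMatrix n r).prod (gaussianMatrix n p)) ∧
    ∫ w, latent i a w * latent i b w ∂((gaussianMatrix n r).prod (gaussianMatrix n p))
      = if a = b then 1 else 0 := by
  rcases a with k | j <;> rcases b with k' | j' <;> simp only [latent]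
  · have h := (gm_memLp (n := n) i k).integrable_mul (gm_memLp i k')
    have h' := h.mul_prod (integrable_const (μ := gaussianMatrix n p) (1 : ℝ))
    have e := integral_prod_mul (μ := gaussianMatrix n r) (ν := gaussianMatrix n p)
      (fun x => x i k * x i k') (fun _ => (1 : ℝ))
    simp only [mul_one, Pi.mul_apply, integral_const, probReal_univ, smul_eq_mul] at h' e
    refine ⟨h', ?_⟩
    rw [e, gm_second]; simp
  · have h' := ((gm_memLp (n := n) i k).integrable (by norm_num)).mul_prod
      ((gm_memLp (n := n) i j').integrable (by norm_num))
    refine ⟨h', ?_⟩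
    rw [integral_prod_mul (μ := gaussianMatrix n r) (ν := gaussianMatrix n p)
      (fun x => x i k) (fun x => x i j'), gm_mean]; simp
  · have h' := ((gm_memLp (n := n) i k').integrable (by norm_num)).mul_prod
      ((gm_memLp (n := n) i j).integrable (by norm_num))
    have hc : ∀ w : (Fin n → Fin r → ℝ) × (Fin n → Fin p → ℝ),
        w.2 i j * w.1 i k' = w.1 i k' * w.2 i j := fun w => mul_comm _ _
    simp_rw [hc]
    refine ⟨h', ?_⟩
    rw [integral_prod_mul (μ := gaussianMatrix n r) (ν := gaussianMatrix n p)
      (fun x => x i k') (fun x => x i j), gm_mean]; simp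
  · have h := (gm_memLp (n := n) i j).integrable_mul (gm_memLp i j')
    have h' := (integrable_const (μ := gaussianMatrix n r) (1 : ℝ)).mul_prod h
    have e := integral_prod_mul (μ := gaussianMatrix n r) (ν := gaussianMatrix n p)
      (fun _ => (1 : ℝ)) (fun x => x i j * x i j')
    simp only [one_mul, Pi.mul_apply, integral_const, probReal_univ, smul_eq_mul] at h' e
    refine ⟨h', ?_⟩
    rw [e, gm_second]; simp

lemma col_norm {p r : ℕ} {V : Matrix (Fin p) (Fin r) ℝ} (hV : IsOrthonormalCols V) (k : Fin r) :
    ∑ j, V j k ^ 2 = 1 := by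
  have := congrFun (congrFun hV k) k
  simpa [Matrix.mul_apply, Matrix.one_apply, sq] using this

lemma spiked_quad {n p r : ℕ} (lam : ℝ) (hl : 0 < lam) (V : Matrix (Fin p) (Fin r) ℝ)
    {W : Matrix (Fin p) (Fin r) ℝ} (hW : IsOrthonormalCols W) :
    Integrable (quadV W) (spikedMeasure n p r (fun _ => lam) V 1) ∧
    ∫ x, quadV W x ∂(spikedMeasure n p r (fun _ => lam) V 1)
      = n * (lam * frobSq (Vᵀ * W) + r) := by
  have hmeas : Measurable (fun w : (Fin n → Fin r → ℝ) × (Fin n → Fin p → ℝ) =>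
      fun i j => (∑ k, w.1 i k * Real.sqrt lam * V j k) + Real.sqrt 1 * w.2 i j) := by fun_prop
  unfold spikedMeasure
  rw [integrable_map_measure (measurable_quadV W).aestronglyMeasurable hmeas.aemeasurable,
    integral_map hmeas.aemeasurable (measurable_quadV W).aestronglyMeasurable]
  have key : ∀ (i : Fin n) (k : Fin r) (w : (Fin n → Fin r → ℝ) × (Fin n → Fin p → ℝ)),
      ∑ j, W j k * ((∑ l, w.1 i l * Real.sqrt lam * V j l) + Real.sqrt 1 * w.2 i j)
      = ∑ a : Fin r ⊕ Fin p, (Sum.elim (fun l => Real.sqrt lam * (Vᵀ * W) l k) (fun j => W j k) a)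
          * latent i a w := by
    intro i k w
    rw [Fintype.sum_sum_type]
    simp only [Sum.elim_inl, Sum.elim_inr, latent, Real.sqrt_one, one_mul, mul_add,
      Finset.sum_add_distrib, Matrix.mul_apply, Matrix.transpose_apply, Finset.mul_sum,
      Finset.sum_mul]
    congr 1
    rw [Finset.sum_comm]
    exact Finset.sum_congr rfl fun a _ => Finset.sum_congr rfl fun b _ => by ring
  have hL := fun (i : Fin n) (k : Fin r) => orthofamily_sq _ (latent (r := r) (p := p) i)
    (fun a b => (latent_ortho i a b).1) (fun a b => (latent_ortho i a b).2)
    (Sum.elim (fun l => Real.sqrt lam * (Vᵀ * W) l k) (fun j => W j k))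
  simp only [Function.comp_def, quadV, key]
  refine ⟨integrable_finsetSum _ fun i _ => integrable_finsetSum _ fun k _ => (hL i k).1, ?_⟩
  rw [integral_finsetSum _ fun i _ => integrable_finsetSum _ fun k _ => (hL i k).1]
  have : ∀ i : Fin n, ∫ w, ∑ k, (∑ a : Fin r ⊕ Fin p,
      (Sum.elim (fun l => Real.sqrt lam * (Vᵀ * W) l k) (fun j => W j k) a)
          * latent i a w) ^ 2 ∂((gaussianMatrix n r).prod (gaussianMatrix n p))
      = lam * frobSq (Vᵀ * W) + r := by
    intro i
    rw [integral_finsetSum _ fun k _ => (hL i k).1]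
    simp_rw [(hL i _).2, Fintype.sum_sum_type, Sum.elim_inl, Sum.elim_inr, col_norm hW,
      Finset.sum_add_distrib, mul_pow, Real.sq_sqrt hl.le, frobSq]
    simp only [Finset.sum_const, Finset.card_univ, Fintype.card_fin, nsmul_eq_mul, mul_one]
    rw [Finset.sum_comm]
    simp_rw [Finset.mul_sum]
  simp_rw [this]
  simp [mul_add]

lemma frobSq_eq_trace {m k : Type*} [Fintype m] [Fintype k] (A : Matrix m k ℝ) :
    frobSq A = (Aᵀ * A).trace := by
  unfold frobSq
  simp only [Matrix.trace, Matrix.diag, Matrix.mul_apply, Matrix.transpose_apply, sq]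
  exact Finset.sum_comm

lemma frobSq_transpose {m k : Type*} [Fintype m] [Fintype k] (A : Matrix m k ℝ) :
    frobSq Aᵀ = frobSq A := by
  unfold frobSq
  exact Finset.sum_comm

lemma frobSq_nonneg {m k : Type*} [Fintype m] [Fintype k] (A : Matrix m k ℝ) :
    0 ≤ frobSq A := by
  unfold frobSq; positivity

lemma frobSq_gram {p r : ℕ} {V : Matrix (Fin p) (Fin r) ℝ} (hV : IsOrthonormalCols V) :
    frobSq (Vᵀ * V) = r := by
  rw [frobSq_eq_trace, show Vᵀ * V = 1 from hV]
  simp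

lemma loss_eq {p r : ℕ} {V W : Matrix (Fin p) (Fin r) ℝ} (hV : IsOrthonormalCols V)
    (hW : IsOrthonormalCols W) : loss V W = 2 * r - 2 * frobSq (Vᵀ * W) := by
  have hV' : Vᵀ * V = 1 := hV
  have hW' : Wᵀ * W = 1 := hW
  unfold loss
  rw [frobSq_eq_trace, frobSq_eq_trace]
  have e : (V * Vᵀ - W * Wᵀ)ᵀ * (V * Vᵀ - W * Wᵀ)
      = V * (Vᵀ * V) * Vᵀ + W * (Wᵀ * W) * Wᵀ - V * (Vᵀ * W) * Wᵀ - W * (Wᵀ * V) * Vᵀ := by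
    simp only [Matrix.transpose_sub, Matrix.transpose_mul, Matrix.transpose_transpose,
      Matrix.sub_mul, Matrix.mul_sub, Matrix.mul_assoc]
    abel
  rw [e, hV', hW', Matrix.mul_one, Matrix.mul_one, Matrix.trace_sub, Matrix.trace_sub,
    Matrix.trace_add, Matrix.trace_mul_comm V, Matrix.trace_mul_comm W, hV', hW',
    Matrix.trace_mul_comm (V * (Vᵀ * W)), Matrix.trace_mul_comm (W * (Wᵀ * V))]
  have e1 : (Wᵀ * (V * (Vᵀ * W))).trace = ((Vᵀ * W)ᵀ * (Vᵀ * W)).trace := by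
    simp [Matrix.transpose_mul, Matrix.mul_assoc]
  have e2 : (Vᵀ * (W * (Wᵀ * V))).trace = ((Vᵀ * W)ᵀ * (Vᵀ * W)).trace := by
    rw [Matrix.trace_mul_comm ((Vᵀ * W)ᵀ)]
    simp [Matrix.transpose_mul, Matrix.mul_assoc]
  rw [e1, e2]
  simp
  ring

/-- The log-likelihood ratio between two spiked measures. -/
def llr {n p r : ℕ} (lam : ℝ) (V W : Matrix (Fin p) (Fin r) ℝ) (x : Fin n → Fin p → ℝ) : ℝ :=
  lam / (2 * (1 + lam)) * (quadV V x - quadV W x)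

lemma dens_eq_exp_llr {n p r : ℕ} (lam : ℝ) (V W : Matrix (Fin p) (Fin r) ℝ)
    (x : Fin n → Fin p → ℝ) : dens lam V x = Real.exp (llr lam V W x) * dens lam W x := by
  unfold dens llr
  rw [mul_left_comm, ← Real.exp_add]
  congr 2
  ring

lemma measurable_llr {n p r : ℕ} (lam : ℝ) (V W : Matrix (Fin p) (Fin r) ℝ) :
    Measurable (llr (n := n) lam V W) := by
  have h1 := measurable_quadV (n := n) V
  have h2 := measurable_quadV (n := n) W
  unfold llr; fun_prop

lemma integral_llr {n p r : ℕ} (lam : ℝ) (hl : 0 < lam) {V W : Matrix (Fin p) (Fin r) ℝ}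
    (hV : IsOrthonormalCols V) (hW : IsOrthonormalCols W) :
    Integrable (llr lam V W) (spikedMeasure n p r (fun _ => lam) V 1) ∧
    ∫ x, llr lam V W x ∂(spikedMeasure n p r (fun _ => lam) V 1)
      = n * hfun lam / 4 * loss V W := by
  obtain ⟨i1, e1⟩ := spiked_quad (n := n) lam hl V hV
  obtain ⟨i2, e2⟩ := spiked_quad (n := n) lam hl V hW
  unfold llr
  refine ⟨(i1.sub i2).const_mul _, ?_⟩
  rw [integral_const_mul, integral_sub i1 i2, e1, e2, frobSq_gram hV, loss_eq hV hW, hfun]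
  field_simp
  ring

/-! ### Testing lower bounds -/

lemma integral_exp_neg_llr {n p r : ℕ} (lam : ℝ) (hl : 0 < lam) {V W : Matrix (Fin p) (Fin r) ℝ}
    (hV : IsOrthonormalCols V) (hW : IsOrthonormalCols W) :
    ∫⁻ x, ENNReal.ofReal (Real.exp (- llr lam V W x)) ∂(spikedMeasure n p r (fun _ => lam) V 1)
      = 1 := by
  have hm := measurable_llr (n := n) lam V W
  rw [spiked_density lam hl hV, lintegral_withDensity_eq_lintegral_mul _
    (measurable_dens lam V).ennreal_ofReal (by fun_prop)]
  have h1 : (spikedMeasure n p r (fun _ => lam) W 1) Set.univ = 1 := measure_univ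
  rw [spiked_density lam hl hW, withDensity_apply _ MeasurableSet.univ, Measure.restrict_univ] at h1
  rw [← h1]
  refine lintegral_congr fun x => ?_
  rw [Pi.mul_apply, ← ENNReal.ofReal_mul (dens_pos lam hl V x).le, dens_eq_exp_llr lam V W x]
  congr 1
  rw [mul_right_comm, ← Real.exp_add]
  simp

lemma pair_test {n p r : ℕ} (lam : ℝ) (hl : 0 < lam) {V W : Matrix (Fin p) (Fin r) ℝ}
    (hV : IsOrthonormalCols V) (hW : IsOrthonormalCols W) (t K : ℝ) (ht : 1 < t)
    (hK : n * hfun lam / 4 * loss V W ≤ K) {A : Set (Fin n → Fin p → ℝ)} (hA : MeasurableSet A) :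
    (spikedMeasure n p r (fun _ => lam) V 1).real A
      ≤ t * (spikedMeasure n p r (fun _ => lam) W 1).real A + (K + 1) / Real.log t := by
  set P := spikedMeasure n p r (fun _ => lam) V 1 with hP
  set Q := spikedMeasure n p r (fun _ => lam) W 1 with hQ
  have hm := measurable_llr (n := n) lam V W
  have hlog : 0 < Real.log t := Real.log_pos ht
  set S : Set (Fin n → Fin p → ℝ) := {x | llr lam V W x ≤ Real.log t} with hSdef
  have hS : MeasurableSet S := measurableSet_le hm measurable_const
  have h1 : P.real A ≤ P.real (A ∩ S) + P.real Sᶜ := by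
    have hsub : A ⊆ (A ∩ S) ∪ Sᶜ := by
      intro x hx
      by_cases h : x ∈ S
      · exact Or.inl ⟨hx, h⟩
      · exact Or.inr h
    exact (measureReal_mono (μ := P) hsub).trans (measureReal_union_le _ _)
  have h2 : P.real (A ∩ S) ≤ t * Q.real A := by
    have : P (A ∩ S) ≤ ENNReal.ofReal t * Q A := by
      rw [hP, hQ, spiked_density lam hl hV, spiked_density lam hl hW,
        withDensity_apply _ (hA.inter hS), withDensity_apply _ hA,
        ← lintegral_const_mul _ (measurable_dens lam W).ennreal_ofReal]
      calc _ ≤ ∫⁻ x in A ∩ S, ENNReal.ofReal t * ENNReal.ofReal (dens lam W x)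
              ∂(gaussianMatrix n p) := by
            refine setLIntegral_mono ?_ fun x hx => ?_
            · exact (measurable_dens lam W).ennreal_ofReal.const_mul _
            · rw [← ENNReal.ofReal_mul (by linarith), dens_eq_exp_llr lam V W x]
              refine ENNReal.ofReal_le_ofReal ?_
              refine mul_le_mul_of_nonneg_right ?_ (dens_pos lam hl W x).le
              have h3 : llr lam V W x ≤ Real.log t := hx.2
              calc Real.exp (llr lam V W x) ≤ Real.exp (Real.log t) := Real.exp_le_exp.2 h3
                _ = t := Real.exp_log (by linarith)
        _ ≤ _ := lintegral_mono_set Set.inter_subset_left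
    have h4 := ENNReal.toReal_mono (ENNReal.mul_ne_top ENNReal.ofReal_ne_top (measure_ne_top _ _)) this
    rw [ENNReal.toReal_mul, ENNReal.toReal_ofReal (by linarith)] at h4
    exact h4
  have h3 : Real.log t * P.real Sᶜ ≤ K + 1 := by
    obtain ⟨i1, e1⟩ := integral_llr (n := n) lam hl hV hW
    have e2 := integral_exp_neg_llr (n := n) lam hl hV hW
    have i2 : Integrable (fun x => Real.exp (- llr lam V W x)) P := by
      refine ⟨Measurable.aestronglyMeasurable (by fun_prop), ?_⟩
      rw [hasFiniteIntegral_iff_ofReal (Filter.Eventually.of_forall fun x => (Real.exp_pos _).le), e2]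
      exact ENNReal.one_lt_top
    have e3 : ∫ x, Real.exp (- llr lam V W x) ∂P = 1 := by
      rw [integral_eq_lintegral_of_nonneg_ae (Filter.Eventually.of_forall fun x => (Real.exp_pos _).le)
        i2.1, e2]
      simp
    have h5 : ∫ x, Sᶜ.indicator (fun _ => Real.log t) x ∂P
        ≤ ∫ x, (llr lam V W x + Real.exp (- llr lam V W x)) ∂P := by
      refine integral_mono ((integrable_const _).indicator hS.compl) (i1.add i2) fun x => ?_
      by_cases hx : x ∈ S
      · rw [Set.indicator_of_notMem (by simpa using hx)]
        have := Real.add_one_le_exp (- llr lam V W x)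
        simp only; linarith
      · rw [Set.indicator_of_mem (by simpa using hx)]
        have h6 : Real.log t < llr lam V W x := not_le.1 hx
        have := Real.exp_pos (- llr lam V W x)
        simp only; linarith
    rw [integral_indicator_const _ hS.compl, integral_add i1 i2, e1, e3, smul_eq_mul] at h5
    linarith
  have h4 : P.real Sᶜ ≤ (K + 1) / Real.log t := by
    rw [le_div_iff₀ hlog]; linarith
  linarith

lemma fano_block {X : Type*} [MeasurableSpace X] {b : ℕ} (hb : 2 ≤ b) (P : Fin b → Measure X)
    [∀ j, IsProbabilityMeasure (P j)] (A : Fin b → Set X) (hA : ∀ j, MeasurableSet (A j))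
    (hd : Pairwise (Function.onFun Disjoint A))
    (htest : ∀ j l, j ≠ l → (P j).real (A j) ≤ 8 * b * (P l).real (A j) + 1 / 2) :
    (b : ℝ) / 34 ≤ ∑ j, (P j).real (A j)ᶜ := by
  have hcomp : ∀ j, (P j).real (A j)ᶜ = 1 - (P j).real (A j) := fun j => probReal_compl_eq_one_sub (hA j)
  simp_rw [hcomp]
  have hsum : ∀ l, ∑ j, (P l).real (A j) ≤ 1 := by
    intro l
    rw [← measureReal_iUnion_fintype hd hA]
    exact measureReal_le_one
  have h1 : ∀ j, ((b : ℝ) - 1) * (P j).real (A j)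
      ≤ 8 * b * (∑ l, (P l).real (A j) - (P j).real (A j)) + ((b : ℝ) - 1) / 2 := by
    intro j
    have h2 : ∑ l ∈ Finset.univ.erase j, (P j).real (A j)
        ≤ ∑ l ∈ Finset.univ.erase j, (8 * b * (P l).real (A j) + 1 / 2) :=
      Finset.sum_le_sum fun l hl => htest j l (Finset.ne_of_mem_erase hl).symm
    rw [Finset.sum_add_distrib, ← Finset.mul_sum,
      Finset.sum_erase_eq_sub (f := fun l => (P l).real (A j)) (Finset.mem_univ j)] at h2
    simp only [Finset.sum_const, Finset.card_erase_of_mem (Finset.mem_univ j), Finset.card_univ,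
      Fintype.card_fin, nsmul_eq_mul, Nat.cast_sub (show 1 ≤ b by omega), Nat.cast_one] at h2
    linarith
  have h3 := Finset.sum_le_sum fun j (_ : j ∈ (Finset.univ : Finset (Fin b))) => h1 j
  rw [← Finset.mul_sum, Finset.sum_add_distrib, ← Finset.mul_sum, Finset.sum_sub_distrib,
    Finset.sum_comm] at h3
  have h4 : ∑ l, ∑ j, (P l).real (A j) ≤ b := by
    calc _ ≤ ∑ l : Fin b, (1 : ℝ) := Finset.sum_le_sum fun l _ => hsum l
      _ = b := by simp
  simp only [Finset.sum_const, Finset.card_univ, Fintype.card_fin, nsmul_eq_mul,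
    Finset.sum_sub_distrib] at h3 ⊢
  set T := ∑ j, (P j).real (A j)
  have hb' : (2 : ℝ) ≤ b := by exact_mod_cast hb
  have h5 : 8 * (b : ℝ) * (∑ l, ∑ j, (P l).real (A j) - T) ≤ 8 * b * (b - T) := by gcongr
  have hbT : 0 ≤ (b : ℝ) - T := by
    have : T ≤ ∑ j : Fin b, (1 : ℝ) := Finset.sum_le_sum fun j _ => measureReal_le_one
    simp at this; linarith
  have h6 : 8 * (b : ℝ) * (b - T) ≤ 16 * (b - 1) * (b - T) :=
    mul_le_mul_of_nonneg_right (by linarith) hbT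
  have h7 : ((b : ℝ) - 1) * (b / 2) ≤ (b - 1) * (17 * (b - T)) := by nlinarith
  have h8 := le_of_mul_le_mul_left h7 (by linarith)
  linarith

lemma assouad {X : Type*} [MeasurableSpace X] {I : Type*} [Fintype I] [DecidableEq I] {b : ℕ}
    (hb : 2 ≤ b) (P : (I → Fin b) → Measure X) [∀ θ, IsProbabilityMeasure (P θ)]
    (d : I → Fin b → X → ℝ) (hm : ∀ i j, Measurable (d i j))
    (hdI : ∀ θ i j, Integrable (d i j) (P θ)) (h0 : ∀ i j x, 0 ≤ d i j x) (D : ℝ) (hD : 0 ≤ D)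
    (hsep : ∀ i j l x, j ≠ l → D ≤ d i j x + d i l x)
    (htest : ∀ θ θ' i, (∀ i', i' ≠ i → θ i' = θ' i') → ∀ A, MeasurableSet A →
      (P θ).real A ≤ 8 * b * (P θ').real A + 1 / 2) :
    ∃ θ, (Fintype.card I : ℝ) * (D / 68) ≤ ∑ i, ∫ x, d i (θ i) x ∂(P θ) := by
  have hblock : ∀ i, ∀ Q : Fin b → (I → Fin b), (∀ j, Q j i = j) →
      (∀ j l i', i' ≠ i → Q j i' = Q l i') →
      (b : ℝ) * (D / 68) ≤ ∑ j, ∫ x, d i (Q j i) x ∂(P (Q j)) := by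
    intro i Q hQ hQ'
    have hA : ∀ j, MeasurableSet {x | d i j x < D / 2} := fun j =>
      measurableSet_lt (hm i j) measurable_const
    have h1 := fano_block hb (fun j => P (Q j)) (fun j => {x | d i j x < D / 2}) hA ?_ ?_
    · have h2 : ∀ j, D / 2 * (P (Q j)).real ({x | d i j x < D / 2})ᶜ
          ≤ ∫ x, d i (Q j i) x ∂(P (Q j)) := by
        intro j
        rw [hQ j]
        have : ∫ x, ({x | d i j x < D / 2})ᶜ.indicator (fun _ => D / 2) x ∂(P (Q j))
            ≤ ∫ x, d i j x ∂(P (Q j)) := by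
          refine integral_mono ((integrable_const _).indicator (hA j).compl) (hdI _ _ _) fun x => ?_
          by_cases hx : d i j x < D / 2
          · rw [Set.indicator_of_notMem (by simpa using hx)]; exact h0 _ _ _
          · rw [Set.indicator_of_mem (by simpa using hx)]; exact not_lt.1 hx
        rw [integral_indicator_const _ (hA j).compl, smul_eq_mul] at this
        linarith
      calc (b : ℝ) * (D / 68) = D / 2 * (b / 34) := by ring
        _ ≤ D / 2 * ∑ j, (P (Q j)).real ({x | d i j x < D / 2})ᶜ := by gcongr
        _ = ∑ j, D / 2 * (P (Q j)).real ({x | d i j x < D / 2})ᶜ := Finset.mul_sum _ _ _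
        _ ≤ _ := Finset.sum_le_sum fun j _ => h2 j
    · intro j l hjl
      rw [Function.onFun, Set.disjoint_left]
      intro x hx hx'
      have := hsep i j l x hjl
      have h1 : d i j x < D / 2 := hx
      have h2 : d i l x < D / 2 := hx'
      linarith
    · intro j l _
      exact htest (Q j) (Q l) i (hQ' j l) _ (hA j)
  have hcoord : ∀ i, (Fintype.card (I → Fin b) : ℝ) * (D / 68)
      ≤ ∑ θ, ∫ x, d i (θ i) x ∂(P θ) := by
    intro i
    let e := Equiv.funSplitAt i (Fin b)
    rw [← e.symm.sum_comp, Fintype.sum_prod_type_right, Fintype.card_congr e, Fintype.card_prod,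
      Fintype.card_fin]
    have : ∀ rest : {j // j ≠ i} → Fin b, (b : ℝ) * (D / 68) ≤
        ∑ j, ∫ x, d i (e.symm (j, rest) i) x ∂(P (e.symm (j, rest))) := by
      intro rest
      refine hblock i (fun j => e.symm (j, rest)) (fun j => ?_) (fun j l i' hi' => ?_)
      · simp [e]
      · simp [e, hi']
    calc _ = ∑ rest : {j // j ≠ i} → Fin b, (b : ℝ) * (D / 68) := by
          rw [Finset.sum_const, Finset.card_univ, nsmul_eq_mul]; push_cast; ring
      _ ≤ _ := Finset.sum_le_sum fun rest _ => this rest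
  have hne : Nonempty (I → Fin b) := ⟨fun _ => ⟨0, by omega⟩⟩
  have htot : ∑ _θ : I → Fin b, (Fintype.card I : ℝ) * (D / 68)
      ≤ ∑ θ : I → Fin b, ∑ i, ∫ x, d i (θ i) x ∂(P θ) := by
    rw [Finset.sum_comm]
    calc _ = ∑ _i : I, (Fintype.card (I → Fin b) : ℝ) * (D / 68) := by
          simp only [Finset.sum_const, Finset.card_univ, nsmul_eq_mul]; ring
      _ ≤ _ := Finset.sum_le_sum fun i _ => hcoord i
  obtain ⟨θ, _, h⟩ := Finset.exists_le_of_sum_le Finset.univ_nonempty htot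
  exact ⟨θ, h⟩

/-! ### The local chart of the Grassmannian -/

open scoped MatrixOrder Matrix.Norms.L2Operator in
lemma exists_chart {m r : ℕ} (B : Matrix (Fin m) (Fin r) ℝ) :
    ∃ G : Matrix (Fin r) (Fin r) ℝ, Gᵀ * (1 + Bᵀ * B) * G = 1 ∧ (1 + Bᵀ * B) * (G * Gᵀ) = 1
      ∧ (G * Gᵀ) * (1 + Bᵀ * B) = 1 := by
  have hpd : (1 + Bᵀ * B).PosDef := by
    have h1 := Matrix.posSemidef_conjTranspose_mul_self B
    rw [Matrix.conjTranspose_eq_transpose_of_trivial] at h1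
    exact Matrix.PosDef.one.add_posSemidef h1
  obtain ⟨S, hS⟩ := (CStarAlgebra.nonneg_iff_eq_star_mul_self).1 (Matrix.nonneg_iff_posSemidef.2 hpd.posSemidef)
  rw [Matrix.star_eq_conjTranspose, Matrix.conjTranspose_eq_transpose_of_trivial] at hS
  have hu : IsUnit (1 + Bᵀ * B).det := (Matrix.isUnit_iff_isUnit_det _).1 hpd.isUnit
  have hSu : IsUnit S.det := by
    rw [hS, Matrix.det_mul, Matrix.det_transpose] at hu
    exact isUnit_of_mul_isUnit_left hu
  have hTu : IsUnit Sᵀ.det := by rwa [Matrix.det_transpose]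
  refine ⟨S⁻¹, ?_, ?_, ?_⟩
  · rw [hS, Matrix.transpose_nonsing_inv, ← Matrix.mul_assoc, Matrix.nonsing_inv_mul _ hTu,
      Matrix.one_mul, Matrix.mul_nonsing_inv _ hSu]
  · rw [hS, Matrix.transpose_nonsing_inv, Matrix.mul_assoc, ← Matrix.mul_assoc S,
      Matrix.mul_nonsing_inv _ hSu, Matrix.one_mul, Matrix.mul_nonsing_inv _ hTu]
  · rw [hS, Matrix.transpose_nonsing_inv, Matrix.mul_assoc, ← Matrix.mul_assoc (Sᵀ)⁻¹,
      Matrix.nonsing_inv_mul _ hTu, Matrix.one_mul, Matrix.nonsing_inv_mul _ hSu]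

/-- The normalizing factor of the chart. -/
def chartG {m r : ℕ} (B : Matrix (Fin m) (Fin r) ℝ) : Matrix (Fin r) (Fin r) ℝ :=
  (exists_chart B).choose

lemma chartG_spec {m r : ℕ} (B : Matrix (Fin m) (Fin r) ℝ) :
    (chartG B)ᵀ * (1 + Bᵀ * B) * chartG B = 1 ∧ (1 + Bᵀ * B) * (chartG B * (chartG B)ᵀ) = 1
      ∧ (chartG B * (chartG B)ᵀ) * (1 + Bᵀ * B) = 1 := (exists_chart B).choose_spec

/-- The matrix with rows of the identity stacked over rows of `B`. -/
def stack {m r : ℕ} (A : Matrix (Fin r) (Fin r) ℝ) (B : Matrix (Fin m) (Fin r) ℝ) :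
    Matrix (Fin (r + m)) (Fin r) ℝ :=
  Matrix.of fun j => Fin.addCases (fun i => A i) (fun a => B a) j

lemma stack_castAdd {m r : ℕ} (A : Matrix (Fin r) (Fin r) ℝ) (B : Matrix (Fin m) (Fin r) ℝ)
    (i c : Fin r) : stack A B (Fin.castAdd m i) c = A i c := by simp [stack]

lemma stack_natAdd {m r : ℕ} (A : Matrix (Fin r) (Fin r) ℝ) (B : Matrix (Fin m) (Fin r) ℝ)
    (a : Fin m) (c : Fin r) : stack A B (Fin.natAdd r a) c = B a c := by simp [stack]

lemma stack_mul {m r : ℕ} (A : Matrix (Fin r) (Fin r) ℝ) (B : Matrix (Fin m) (Fin r) ℝ)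
    (G : Matrix (Fin r) (Fin r) ℝ) : stack A B * G = stack (A * G) (B * G) := by
  ext j c
  refine Fin.addCases (fun i => ?_) (fun a => ?_) j
  · simp [Matrix.mul_apply, stack_castAdd]
  · simp [Matrix.mul_apply, stack_natAdd]

lemma stack_gram {m r : ℕ} (A : Matrix (Fin r) (Fin r) ℝ) (B : Matrix (Fin m) (Fin r) ℝ) :
    (stack A B)ᵀ * stack A B = Aᵀ * A + Bᵀ * B := by
  ext c d
  simp [Matrix.mul_apply, Fin.sum_univ_add, stack_castAdd, stack_natAdd]

/-- The chart. -/
def chartV {m r : ℕ} (B : Matrix (Fin m) (Fin r) ℝ) : Matrix (Fin (r + m)) (Fin r) ℝ :=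
  stack 1 B * chartG B

lemma chartV_orth {m r : ℕ} (B : Matrix (Fin m) (Fin r) ℝ) : IsOrthonormalCols (chartV B) := by
  unfold IsOrthonormalCols chartV
  rw [Matrix.transpose_mul, Matrix.mul_assoc, ← Matrix.mul_assoc _ _ (chartG B), stack_gram]
  rw [Matrix.transpose_one, Matrix.one_mul, ← Matrix.mul_assoc]
  exact (chartG_spec B).1

lemma loss_le_resid {p r : ℕ} {V W : Matrix (Fin p) (Fin r) ℝ} (hV : IsOrthonormalCols V)
    (hW : IsOrthonormalCols W) (H : Matrix (Fin r) (Fin r) ℝ) :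
    loss V W ≤ 2 * frobSq (V - W * H) := by
  have hV' : Vᵀ * V = 1 := hV
  have hW' : Wᵀ * W = 1 := hW
  rw [loss_eq hV hW]
  have h0 : 0 ≤ frobSq (Wᵀ * V - H) := frobSq_nonneg _
  rw [← frobSq_transpose (Vᵀ * W)]
  rw [frobSq_eq_trace] at h0 ⊢
  rw [frobSq_eq_trace]
  simp only [Matrix.transpose_sub, Matrix.transpose_mul, Matrix.transpose_transpose] at h0 ⊢
  have e1 : (Vᵀ * W - Hᵀ) * (Wᵀ * V - H)
      = Vᵀ * W * (Wᵀ * V) - Vᵀ * W * H - Hᵀ * (Wᵀ * V) + Hᵀ * H := by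
    simp only [Matrix.sub_mul, Matrix.mul_sub]; abel
  have e2 : (Vᵀ - Hᵀ * Wᵀ) * (V - W * H)
      = Vᵀ * V - Vᵀ * W * H - Hᵀ * (Wᵀ * V) + Hᵀ * (Wᵀ * W) * H := by
    simp only [Matrix.sub_mul, Matrix.mul_sub, Matrix.mul_assoc]; abel
  rw [e1] at h0
  rw [e2, hV', hW']
  simp only [Matrix.trace_add, Matrix.trace_sub, Matrix.mul_one, Matrix.trace_one,
    Fintype.card_fin] at h0 ⊢
  linarith

lemma chart_gram {m r : ℕ} (B : Matrix (Fin m) (Fin r) ℝ) :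
    Bᵀ * B * (chartG B * (chartG B)ᵀ) = 1 - chartG B * (chartG B)ᵀ := by
  have h := (chartG_spec B).2.1
  rw [Matrix.add_mul, Matrix.one_mul] at h
  rw [← h]; abel

lemma chart_contr {m r k : ℕ} (B : Matrix (Fin m) (Fin r) ℝ) (X : Matrix (Fin k) (Fin r) ℝ) :
    frobSq (X * chartG B) ≤ frobSq X ∧ frobSq (X * (chartG B * (chartG B)ᵀ)) ≤ frobSq X := by
  have hg := chart_gram B
  set G := chartG B
  set N := G * Gᵀ with hN
  have hNt : Nᵀ = N := by simp [hN]
  have q1 := frobSq_nonneg (X - X * N)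
  have q2 := frobSq_nonneg (X * N * Bᵀ)
  rw [← frobSq_transpose, frobSq_eq_trace] at q1 q2
  rw [← frobSq_transpose (X * G), ← frobSq_transpose (X * N), ← frobSq_transpose X,
    frobSq_eq_trace, frobSq_eq_trace, frobSq_eq_trace]
  simp only [Matrix.transpose_sub, Matrix.transpose_mul, Matrix.transpose_transpose, hNt]
    at q1 q2 ⊢
  have e2 : X * N * Bᵀ * (B * (N * Xᵀ)) = X * N * Xᵀ - X * N * (N * Xᵀ) := by
    calc _ = X * N * (Bᵀ * B * N) * Xᵀ := by simp only [Matrix.mul_assoc]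
      _ = _ := by rw [hg]; simp only [Matrix.mul_sub, Matrix.sub_mul, Matrix.mul_assoc, Matrix.mul_one]
  have e1 : (X - X * N) * (Xᵀ - N * Xᵀ) = X * Xᵀ - X * N * Xᵀ - X * N * Xᵀ + X * N * (N * Xᵀ) := by
    simp only [Matrix.mul_sub, Matrix.sub_mul, Matrix.mul_assoc]; abel
  have e3 : X * G * (Gᵀ * Xᵀ) = X * N * Xᵀ := by simp only [hN, Matrix.mul_assoc]
  rw [e1] at q1
  rw [e2] at q2
  rw [e3]
  simp only [Matrix.trace_add, Matrix.trace_sub] at q1 q2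
  constructor <;> linarith

lemma frobSq_stack_zero {m r : ℕ} (B : Matrix (Fin m) (Fin r) ℝ) :
    frobSq (stack 0 B) = frobSq B := by
  simp [frobSq, Fin.sum_univ_add, stack_castAdd, stack_natAdd]

lemma chart_loss {m r : ℕ} (B B' : Matrix (Fin m) (Fin r) ℝ) :
    loss (chartV B) (chartV B') ≤ 2 * frobSq (B - B') := by
  have h := loss_le_resid (chartV_orth B) (chartV_orth B')
    ((chartG B')ᵀ * (1 + B'ᵀ * B') * chartG B)
  have e : chartV B - chartV B' * ((chartG B')ᵀ * (1 + B'ᵀ * B') * chartG B)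
      = stack 0 ((B - B')) * chartG B := by
    have h1 : chartV B' * ((chartG B')ᵀ * (1 + B'ᵀ * B') * chartG B) = stack 1 B' * chartG B := by
      unfold chartV
      calc _ = stack 1 B' * (chartG B' * (chartG B')ᵀ * (1 + B'ᵀ * B')) * chartG B := by
            simp only [Matrix.mul_assoc]
        _ = _ := by rw [(chartG_spec B').2.2, Matrix.mul_one]
    rw [h1, chartV, ← Matrix.sub_mul]
    congr 1
    ext j c
    refine Fin.addCases (fun i => ?_) (fun a => ?_) j
    · simp [stack_castAdd]
    · simp [stack_natAdd]
  rw [e] at h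
  have h2 := (chart_contr B (stack 0 (B - B'))).1
  rw [frobSq_stack_zero] at h2
  linarith

lemma frobSq_mul_le {a b c : ℕ} (A : Matrix (Fin a) (Fin b) ℝ) (B : Matrix (Fin b) (Fin c) ℝ) :
    frobSq (A * B) ≤ frobSq A * frobSq B := by
  unfold frobSq
  calc ∑ i, ∑ j, ((A * B) i j) ^ 2 ≤ ∑ i, ∑ j, (∑ k, A i k ^ 2) * (∑ k, B k j ^ 2) := by
        refine Finset.sum_le_sum fun i _ => Finset.sum_le_sum fun j _ => ?_
        rw [Matrix.mul_apply]
        exact Finset.sum_mul_sq_le_sq_mul_sq _ _ _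
    _ = _ := by
        rw [Finset.sum_mul]
        refine Finset.sum_congr rfl fun i _ => ?_
        rw [← Finset.mul_sum, Finset.sum_comm]

lemma chart_block {m r : ℕ} (B : Matrix (Fin m) (Fin r) ℝ) (a : Fin m) (c : Fin r) :
    (chartV B * (chartV B)ᵀ) (Fin.natAdd r a) (Fin.castAdd m c)
      = (B * (chartG B * (chartG B)ᵀ)) a c := by
  have : chartV B * (chartV B)ᵀ = stack (chartG B * (chartG B)ᵀ) (B * (chartG B * (chartG B)ᵀ))
      * (stack 1 B)ᵀ := by
    unfold chartV
    rw [Matrix.transpose_mul, ← Matrix.mul_assoc, Matrix.mul_assoc (stack 1 B), stack_mul,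
      Matrix.one_mul]
  rw [this, Matrix.mul_apply]
  simp [stack_castAdd, stack_natAdd, Matrix.one_apply]

lemma chart_block_close {m r : ℕ} (B : Matrix (Fin m) (Fin r) ℝ) :
    frobSq (B - B * (chartG B * (chartG B)ᵀ)) ≤ frobSq B ^ 3 := by
  have e : B - B * (chartG B * (chartG B)ᵀ) = B * (Bᵀ * B) * (chartG B * (chartG B)ᵀ) := by
    rw [Matrix.mul_assoc, chart_gram, Matrix.mul_sub, Matrix.mul_one]
  rw [e]
  refine (chart_contr B _).2.trans ?_
  have h0 := frobSq_nonneg B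
  calc frobSq (B * (Bᵀ * B)) ≤ frobSq B * frobSq (Bᵀ * B) := frobSq_mul_le _ _
    _ ≤ frobSq B * (frobSq Bᵀ * frobSq B) := by gcongr; exact frobSq_mul_le _ _
    _ = _ := by rw [frobSq_transpose]; ring

/-- Reduction of the block error to the loss. -/
lemma block_le_loss {m r : ℕ} (B : Matrix (Fin m) (Fin r) ℝ) (W : Matrix (Fin (r + m)) (Fin r) ℝ) :
    ∑ a, ∑ c, ((W * Wᵀ) (Fin.natAdd r a) (Fin.castAdd m c) - B a c) ^ 2
      ≤ 2 * loss W (chartV B) + 2 * frobSq B ^ 3 := by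
  have h1 : ∑ a, ∑ c, ((W * Wᵀ) (Fin.natAdd r a) (Fin.castAdd m c)
      - (B * (chartG B * (chartG B)ᵀ)) a c) ^ 2 ≤ loss W (chartV B) := by
    unfold loss frobSq
    rw [Fin.sum_univ_add]
    have hn : 0 ≤ ∑ i : Fin r, ∑ j, ((W * Wᵀ - chartV B * (chartV B)ᵀ) (Fin.castAdd m i) j) ^ 2 :=
      Finset.sum_nonneg fun _ _ => Finset.sum_nonneg fun _ _ => sq_nonneg _
    refine le_trans ?_ (le_add_of_nonneg_left hn)
    refine Finset.sum_le_sum fun a _ => ?_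
    rw [Fin.sum_univ_add]
    refine le_trans (le_of_eq ?_) (le_add_of_nonneg_right
      (Finset.sum_nonneg fun _ _ => sq_nonneg _))
    refine Finset.sum_congr rfl fun c _ => ?_
    rw [Matrix.sub_apply, chart_block]
  have h2 := chart_block_close B
  unfold frobSq at h2
  have h3 : ∑ a, ∑ c, ((W * Wᵀ) (Fin.natAdd r a) (Fin.castAdd m c) - B a c) ^ 2
      ≤ 2 * ∑ a, ∑ c, ((W * Wᵀ) (Fin.natAdd r a) (Fin.castAdd m c)
      - (B * (chartG B * (chartG B)ᵀ)) a c) ^ 2 +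
      2 * ∑ a, ∑ c, ((B - B * (chartG B * (chartG B)ᵀ)) a c) ^ 2 := by
    simp only [Finset.mul_sum, ← Finset.sum_add_distrib]
    refine Finset.sum_le_sum fun a _ => Finset.sum_le_sum fun c _ => ?_
    rw [Matrix.sub_apply]
    nlinarith [sq_nonneg ((W * Wᵀ) (Fin.natAdd r a) (Fin.castAdd m c)
      - (B * (chartG B * (chartG B)ᵀ)) a c + (B a c - (B * (chartG B * (chartG B)ᵀ)) a c))]
  unfold frobSq
  linarith

/-! ### Sparsity of the chart and reduction of the minimax risk -/

lemma weakLq_zero_le {p r : ℕ} (V : Matrix (Fin p) (Fin r) ℝ) (T : Finset (Fin p))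
    (hT : ∀ j, rowNorm V j ≠ 0 → j ∈ T) (s : ℕ) (hs : T.card ≤ s) : weakLq 0 V ≤ s := by
  unfold weakLq
  refine Real.iSup_le (fun j => ?_) (Nat.cast_nonneg s)
  by_cases h : sortedRowNorm V j = 0
  · simp [h]
  · simp only [if_neg h, Real.rpow_zero, mul_one]
    have hpos : 0 < sortedRowNorm V j := lt_of_le_of_ne (Real.sqrt_nonneg _) (Ne.symm h)
    have hsub : (Finset.Iic j).map (Tuple.sort (fun i => - rowNorm V i)).toEmbedding ⊆ T := by
      intro x hx
      rw [Finset.mem_map] at hx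
      obtain ⟨i, hi, rfl⟩ := hx
      rw [Finset.mem_Iic] at hi
      refine hT _ ?_
      have hm := Tuple.monotone_sort (fun i => - rowNorm V i) hi
      simp only [Function.comp_apply, neg_le_neg_iff] at hm
      have h2 : 0 < rowNorm V ((Tuple.sort (fun i => - rowNorm V i)) i) := lt_of_lt_of_le hpos hm
      exact h2.ne'
    have hc := Finset.card_le_card hsub
    rw [Finset.card_map, Fin.card_Iic] at hc
    exact_mod_cast hc.trans hs

lemma chart_sparse {m r k : ℕ} (B : Matrix (Fin m) (Fin r) ℝ) (S : Finset (Fin m))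
    (hS : ∀ a c, B a c ≠ 0 → a ∈ S) (hk : S.card ≤ k) :
    weakLq 0 (chartV B) ≤ ((r + k : ℕ) : ℝ) := by
  refine weakLq_zero_le _ (Finset.univ.image (Fin.castAdd m) ∪ S.image (Fin.natAdd r)) ?_ _ ?_
  · intro j
    refine Fin.addCases (fun i _ => ?_) (fun a h => ?_) j
    · simp
    · by_cases ha : a ∈ S
      · rw [Finset.mem_union]
        exact Or.inr (Finset.mem_image_of_mem _ ha)
      · exfalso
        apply h
        have hz : ∀ c, B a c = 0 := fun c => by
          by_contra hne
          exact ha (hS a c hne)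
        have hz2 : ∀ c, chartV B (Fin.natAdd r a) c = 0 := fun c => by
          rw [chartV, stack_mul, stack_natAdd, Matrix.mul_apply]
          simp [hz]
        simp [rowNorm, hz2]
  · refine (Finset.card_union_le _ _).trans ?_
    refine add_le_add ?_ (Finset.card_image_le.trans hk)
    exact Finset.card_image_le.trans (by simp)

lemma loss_nonneg {p r : ℕ} (V W : Matrix (Fin p) (Fin r) ℝ) : 0 ≤ loss V W := frobSq_nonneg _

lemma loss_bound {p r : ℕ} {V W : Matrix (Fin p) (Fin r) ℝ} (hV : IsOrthonormalCols V)
    (hW : IsOrthonormalCols W) : loss V W ≤ 2 * r := by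
  rw [loss_eq hV hW]
  have := frobSq_nonneg (Vᵀ * W)
  linarith

lemma minimax_nonneg (q : ℝ) (n p r : ℕ) (s lam κ : ℝ) : 0 ≤ minimaxRisk q n p r s lam κ := by
  unfold minimaxRisk
  refine Real.iInf_nonneg fun est => Real.iSup_nonneg fun V => Real.iSup_nonneg fun Λ =>
    Real.iSup_nonneg fun _ => integral_nonneg fun x => loss_nonneg _ _

lemma integral_loss_le {n p r : ℕ} (est : (Fin n → Fin p → ℝ) → (Fin p → Fin r → ℝ))
    (he : ∀ x, IsOrthonormalCols (Matrix.of (est x))) {V : Matrix (Fin p) (Fin r) ℝ}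
    (hV : IsOrthonormalCols V) (Λ : Fin r → ℝ) :
    ∫ x, loss (Matrix.of (est x)) V ∂ spikedMeasure n p r Λ V 1 ≤ 2 * r := by
  have h := integral_mono_of_nonneg (μ := spikedMeasure n p r Λ V 1)
    (f := fun x => loss (Matrix.of (est x)) V) (g := fun _ => (2 * r : ℝ))
    (Filter.Eventually.of_forall fun x => loss_nonneg _ _) (integrable_const _)
    (Filter.Eventually.of_forall fun x => loss_bound (he x) hV)
  simpa using h

lemma minimax_ge {n m r : ℕ} (s lam κ c : ℝ)
    (h : ∀ est : (Fin n → Fin (r + m) → ℝ) → (Fin (r + m) → Fin r → ℝ), Measurable est →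
      (∀ x, IsOrthonormalCols (Matrix.of (est x))) →
      ∃ V Λ, InTheta 0 s (r + m) r lam κ V Λ ∧
        c ≤ ∫ x, loss (Matrix.of (est x)) V ∂ spikedMeasure n (r + m) r Λ V 1) :
    c ≤ minimaxRisk 0 n (r + m) r s lam κ := by
  unfold minimaxRisk
  haveI : Nonempty {f : (Fin n → Fin (r + m) → ℝ) → (Fin (r + m) → Fin r → ℝ) //
      Measurable f ∧ ∀ x, IsOrthonormalCols (Matrix.of (f x))} :=
    ⟨⟨fun _ => chartV 0, measurable_const, fun _ => chartV_orth 0⟩⟩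
  refine le_ciInf fun est => ?_
  obtain ⟨V, Λ, hT, hc⟩ := h est.1 est.2.1 est.2.2
  have hb3 : ∀ V Λ, ∀ _ : InTheta 0 s (r + m) r lam κ V Λ,
      ∫ x, loss (Matrix.of (est.1 x)) V ∂ spikedMeasure n (r + m) r Λ V 1 ≤ 2 * r :=
    fun V Λ hT => integral_loss_le _ est.2.2 hT.1 Λ
  have h0 : (0 : ℝ) ≤ 2 * r := by positivity
  have hb2 : ∀ V Λ, (⨆ (_ : InTheta 0 s (r + m) r lam κ V Λ),
      ∫ x, loss (Matrix.of (est.1 x)) V ∂ spikedMeasure n (r + m) r Λ V 1) ≤ 2 * r :=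
    fun V Λ => Real.iSup_le (hb3 V Λ) h0
  have hb1 : ∀ V, (⨆ (Λ : Fin r → ℝ) (_ : InTheta 0 s (r + m) r lam κ V Λ),
      ∫ x, loss (Matrix.of (est.1 x)) V ∂ spikedMeasure n (r + m) r Λ V 1) ≤ 2 * r :=
    fun V => Real.iSup_le (hb2 V) h0
  refine hc.trans ?_
  refine le_trans ?_ (le_ciSup (f := fun V => ⨆ (Λ : Fin r → ℝ)
    (_ : InTheta 0 s (r + m) r lam κ V Λ),
      ∫ x, loss (Matrix.of (est.1 x)) V ∂ spikedMeasure n (r + m) r Λ V 1)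
    ⟨2 * r, by rintro _ ⟨V, rfl⟩; exact hb1 V⟩ V)
  refine le_trans ?_ (le_ciSup (f := fun Λ => ⨆ (_ : InTheta 0 s (r + m) r lam κ V Λ),
      ∫ x, loss (Matrix.of (est.1 x)) V ∂ spikedMeasure n (r + m) r Λ V 1)
    ⟨2 * r, by rintro _ ⟨V, rfl⟩; exact hb2 _ V⟩ Λ)
  exact le_ciSup (f := fun _ : InTheta 0 s (r + m) r lam κ V Λ =>
      ∫ x, loss (Matrix.of (est.1 x)) V ∂ spikedMeasure n (r + m) r Λ V 1)
    ⟨2 * r, by rintro _ ⟨h, rfl⟩; exact hb3 _ _ h⟩ hT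

/-! ### Lower bound from a product family -/

lemma entry_bound {p r : ℕ} {W : Matrix (Fin p) (Fin r) ℝ} (hW : IsOrthonormalCols W)
    (i j : Fin p) : |(W * Wᵀ) i j| ≤ r := by
  have h1 : frobSq W = r := by
    rw [frobSq_eq_trace, show Wᵀ * W = 1 from hW]; simp
  have h2 : frobSq (W * Wᵀ) ≤ (r : ℝ) ^ 2 := by
    refine (frobSq_mul_le _ _).trans (le_of_eq ?_)
    rw [frobSq_transpose, h1]; ring
  have h3 : ((W * Wᵀ) i j) ^ 2 ≤ frobSq (W * Wᵀ) := by
    unfold frobSq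
    refine le_trans ?_ (Finset.single_le_sum (f := fun i => ∑ j, ((W * Wᵀ) i j) ^ 2)
      (fun i _ => Finset.sum_nonneg fun _ _ => sq_nonneg _) (Finset.mem_univ i))
    exact Finset.single_le_sum (f := fun j => ((W * Wᵀ) i j) ^ 2)
      (fun i _ => sq_nonneg _) (Finset.mem_univ j)
  exact abs_le_of_sq_le_sq (h3.trans h2) (by positivity)

lemma measurable_entry {n p r : ℕ} {est : (Fin n → Fin p → ℝ) → (Fin p → Fin r → ℝ)}
    (he : Measurable est) (i j : Fin p) :
    Measurable fun x => (Matrix.of (est x) * (Matrix.of (est x))ᵀ) i j := by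
  have h : ∀ i k, Measurable fun x => est x i k := fun i k =>
    measurable_pi_iff.1 (measurable_pi_iff.1 he i) k
  simp only [Matrix.mul_apply, Matrix.transpose_apply, Matrix.of_apply]
  exact Finset.measurable_sum _ fun k _ => (h i k).mul (h j k)

lemma integrable_loss {n p r : ℕ} {est : (Fin n → Fin p → ℝ) → (Fin p → Fin r → ℝ)}
    (he : Measurable est) (ho : ∀ x, IsOrthonormalCols (Matrix.of (est x)))
    {V : Matrix (Fin p) (Fin r) ℝ} (hV : IsOrthonormalCols V)
    (μ : Measure (Fin n → Fin p → ℝ)) [IsProbabilityMeasure μ] :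
    Integrable (fun x => loss (Matrix.of (est x)) V) μ := by
  refine Integrable.of_bound (Measurable.aestronglyMeasurable ?_) (2 * r)
    (Filter.Eventually.of_forall fun x => ?_)
  · unfold loss frobSq
    refine Finset.measurable_sum _ fun i _ => Finset.measurable_sum _ fun j _ => ?_
    simp only [Matrix.sub_apply]
    exact ((measurable_entry he i j).sub_const _).pow_const 2
  · rw [Real.norm_eq_abs, abs_of_nonneg (loss_nonneg _ _)]
    exact loss_bound (ho x) hV

lemma log_test (b : ℕ) (hb : 2 ≤ b) :
    (Real.log b / 2 + 1) / Real.log (8 * b) ≤ 1 / 2 := by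
  have hb0 : (2 : ℝ) ≤ b := by exact_mod_cast hb
  have h8 : (2 : ℝ) ≤ Real.log 8 := by
    have : Real.log 8 = 3 * Real.log 2 := by
      rw [show (8 : ℝ) = 2 ^ 3 by norm_num, Real.log_pow]; norm_num
    have := Real.log_two_gt_d9
    linarith
  have hlb : 0 ≤ Real.log b := Real.log_nonneg (by linarith)
  rw [Real.log_mul (by norm_num) (by linarith), div_le_iff₀ (by linarith)]
  linarith

lemma family_bound {n m r k : ℕ} (κ lam : ℝ) (hκ : 1 < κ) (hl : 0 < lam) {I : Type*} [Fintype I]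
    [DecidableEq I] {b : ℕ} (hb : 2 ≤ b) (pos : Fin m → Fin r → I)
    (val : Fin m → Fin r → Fin b → ℝ) (δ2 ρ : ℝ)
    (hS : ∀ θ : I → Fin b, ∃ S : Finset (Fin m), S.card ≤ k ∧
      ∀ a c, val a c (θ (pos a c)) ≠ 0 → a ∈ S)
    (hlow : ∀ i j l, j ≠ l →
      δ2 ≤ ∑ a, ∑ c, if pos a c = i then (val a c j - val a c l) ^ 2 else 0)
    (hup : ∀ i j l, (∑ a, ∑ c, if pos a c = i then (val a c j - val a c l) ^ 2 else 0) ≤ 4 * δ2)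
    (hρ : ∀ θ : I → Fin b, ∑ a, ∑ c, (val a c (θ (pos a c))) ^ 2 ≤ ρ)
    (hρ2 : (Fintype.card I : ℝ) * δ2 = ρ) (hρ3 : ρ ≤ 1 / 24) (hδ : 0 ≤ δ2)
    (hn : n * hfun lam * δ2 ≤ Real.log b / 4) :
    ρ / 544 ≤ minimaxRisk 0 n (r + m) r ((r + k : ℕ) : ℝ) lam κ := by
  have hρ0 : 0 ≤ ρ := by rw [← hρ2]; positivity
  refine minimax_ge _ _ _ _ fun est he ho => ?_
  let B : (I → Fin b) → Matrix (Fin m) (Fin r) ℝ := fun θ =>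
    Matrix.of fun a c => val a c (θ (pos a c))
  let P : (I → Fin b) → Measure (Fin n → Fin (r + m) → ℝ) := fun θ =>
    spikedMeasure n (r + m) r (fun _ => lam) (chartV (B θ)) 1
  have hP : ∀ θ, IsProbabilityMeasure (P θ) := fun θ => instProbSpiked _ _ _
  let E : (Fin n → Fin (r + m) → ℝ) → Fin m → Fin r → ℝ := fun x a c =>
    (Matrix.of (est x) * (Matrix.of (est x))ᵀ) (Fin.natAdd r a) (Fin.castAdd m c)
  have hEm : ∀ a c, Measurable fun x => E x a c := fun a c => measurable_entry he _ _
  let d : I → Fin b → (Fin n → Fin (r + m) → ℝ) → ℝ := fun i j x =>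
    ∑ a, ∑ c, if pos a c = i then (E x a c - val a c j) ^ 2 else 0
  have hdm : ∀ i j, Measurable (d i j) := by
    intro i j
    refine Finset.measurable_sum _ fun a _ => Finset.measurable_sum _ fun c _ => ?_
    by_cases h : pos a c = i
    · simp only [h, if_true]; exact ((hEm a c).sub_const _).pow_const 2
    · simp only [h, if_false]; exact measurable_const
  have hdint : ∀ θ i j, Integrable (d i j) (P θ) := by
    intro θ i j
    refine integrable_finsetSum _ fun a _ => integrable_finsetSum _ fun c _ => ?_
    by_cases h : pos a c = i
    · simp only [h, if_true]
      refine Integrable.of_bound (((hEm a c).sub_const _).pow_const 2).aestronglyMeasurable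
        ((r + |val a c j|) ^ 2) (Filter.Eventually.of_forall fun x => ?_)
      rw [Real.norm_eq_abs, abs_pow]
      have h1 : |E x a c - val a c j| ≤ r + |val a c j| :=
        (abs_sub _ _).trans (by gcongr; exact entry_bound (ho x) _ _)
      gcongr
    · simp only [h, if_false]; exact integrable_const _
  have hd0 : ∀ i j x, 0 ≤ d i j x := fun i j x =>
    Finset.sum_nonneg fun a _ => Finset.sum_nonneg fun c _ => by
      split_ifs
      · exact sq_nonneg _
      · exact le_rfl
  have hsep : ∀ i j l x, j ≠ l → δ2 / 2 ≤ d i j x + d i l x := by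
    intro i j l x hjl
    have h1 := hlow i j l hjl
    have h2 : (∑ a, ∑ c, if pos a c = i then (val a c j - val a c l) ^ 2 else 0)
        ≤ 2 * (d i j x + d i l x) := by
      simp only [d, ← Finset.sum_add_distrib, Finset.mul_sum]
      refine Finset.sum_le_sum fun a _ => Finset.sum_le_sum fun c _ => ?_
      split_ifs
      · nlinarith [sq_nonneg (E x a c - val a c j + (E x a c - val a c l))]
      · norm_num
    linarith
  have hsum : ∀ θ x, ∑ i, d i (θ i) x = ∑ a, ∑ c, (E x a c - B θ a c) ^ 2 := by
    intro θ x
    simp only [d]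
    rw [Finset.sum_comm]
    refine Finset.sum_congr rfl fun a _ => ?_
    rw [Finset.sum_comm]
    refine Finset.sum_congr rfl fun c _ => ?_
    rw [Finset.sum_ite_eq]
    simp [B]
  have hh : 0 < hfun lam := by unfold hfun; positivity
  have htest : ∀ θ θ' i, (∀ i', i' ≠ i → θ i' = θ' i') → ∀ A, MeasurableSet A →
      (P θ).real A ≤ 8 * b * (P θ').real A + 1 / 2 := by
    intro θ θ' i hθ A hA
    have hb0 : (2 : ℝ) ≤ b := by exact_mod_cast hb
    have hL : loss (chartV (B θ)) (chartV (B θ')) ≤ 8 * δ2 := by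
      refine (chart_loss _ _).trans ?_
      have h1 : frobSq (B θ - B θ') ≤ 4 * δ2 := by
        refine le_trans ?_ (hup i (θ i) (θ' i))
        unfold frobSq
        refine Finset.sum_le_sum fun a _ => Finset.sum_le_sum fun c _ => ?_
        simp only [B, Matrix.sub_apply, Matrix.of_apply]
        split_ifs with h
        · rw [h]
        · rw [hθ _ h]; simp
      linarith
    have hK : n * hfun lam / 4 * loss (chartV (B θ)) (chartV (B θ')) ≤ Real.log b / 2 := by
      calc _ ≤ n * hfun lam / 4 * (8 * δ2) := by gcongr
        _ = 2 * (n * hfun lam * δ2) := by ring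
        _ ≤ _ := by linarith
    have h := pair_test (n := n) lam hl (chartV_orth (B θ)) (chartV_orth (B θ')) (8 * b) _
      (by linarith) hK hA
    have h2 := log_test b hb
    exact h.trans (by gcongr)
  obtain ⟨θ, hθ⟩ := assouad hb P d hdm hdint hd0 (δ2 / 2) (by linarith) hsep htest
  refine ⟨chartV (B θ), fun _ => lam, ⟨chartV_orth _, ?_, antitone_const, fun _ => ⟨hl, le_rfl, ?_⟩⟩, ?_⟩
  · obtain ⟨S, hS1, hS2⟩ := hS θ
    exact chart_sparse (B θ) S hS2 hS1
  · nlinarith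
  · have hmono : ∫ x, ((1 / 2) * ∑ i, d i (θ i) x - ρ ^ 3) ∂(P θ)
        ≤ ∫ x, loss (Matrix.of (est x)) (chartV (B θ)) ∂(P θ) := by
      refine integral_mono ?_ (integrable_loss he ho (chartV_orth _) _) fun x => ?_
      · exact ((integrable_finsetSum _ fun i _ => hdint θ i (θ i)).const_mul _).sub
          (integrable_const _)
      · have h1 := block_le_loss (B θ) (Matrix.of (est x))
        have h2 : frobSq (B θ) ^ 3 ≤ ρ ^ 3 := by
          have := frobSq_nonneg (B θ)
          have := hρ θ
          gcongr
          exact this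
        have h3 := hsum θ x
        simp only
        rw [h3]
        linarith
    rw [integral_sub ((integrable_finsetSum _ fun i _ => hdint θ i (θ i)).const_mul _)
      (integrable_const _), integral_const_mul, integral_finsetSum _
      fun i _ => hdint θ i (θ i)] at hmono
    simp only [integral_const, probReal_univ, one_smul, smul_eq_mul, one_mul] at hmono
    refine le_trans ?_ hmono
    have h5 : (Fintype.card I : ℝ) * (δ2 / 2 / 68) = ρ / 136 := by rw [← hρ2]; ring
    rw [h5] at hθ
    have h6 : ρ ^ 3 ≤ ρ / 544 := by
      have : ρ ^ 2 ≤ 1 / 544 := by nlinarith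
      nlinarith
    linarith

/-! ### The two families -/

/-- The squared radius of one coordinate of the family. -/
def radius (q L u : ℝ) : ℝ := min (L / (4 * u)) (1 / (24 * q))

lemma radius_spec (q L u : ℝ) (hq : 0 < q) (hL : 0 < L) (hu : 0 < u) :
    0 ≤ radius q L u ∧ q * radius q L u ≤ 1 / 24 ∧ u * radius q L u ≤ L / 4 ∧
      1 / 24 * min (q * L / u) 1 ≤ q * radius q L u := by
  unfold radius
  refine ⟨by positivity, ?_, ?_, ?_⟩
  · calc q * min (L / (4 * u)) (1 / (24 * q)) ≤ q * (1 / (24 * q)) := by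
          gcongr; exact min_le_right _ _
      _ = 1 / 24 := by field_simp
  · calc u * min (L / (4 * u)) (1 / (24 * q)) ≤ u * (L / (4 * u)) := by
          gcongr; exact min_le_left _ _
      _ = L / 4 := by field_simp
  · rw [mul_min_of_nonneg _ _ hq.le]
    refine le_min ?_ ?_
    · calc 1 / 24 * min (q * L / u) 1 ≤ 1 / 24 * (q * L / u) := by gcongr; exact min_le_left _ _
        _ ≤ 1 / 4 * (q * L / u) := by gcongr; norm_num
        _ = q * (L / (4 * u)) := by field_simp
    · calc 1 / 24 * min (q * L / u) 1 ≤ 1 / 24 * 1 := by gcongr; exact min_le_right _ _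
        _ = q * (1 / (24 * q)) := by field_simp

lemma familyA {n l r k : ℕ} (κ lam : ℝ) (hκ : 1 < κ) (hl : 0 < lam) (hn : 0 < n) (hr : 1 ≤ r)
    (hk : 1 ≤ k) :
    1 / 13056 * min ((r : ℝ) * k * Real.log 2 / (n * hfun lam)) 1
      ≤ minimaxRisk 0 n (r + (k + l)) r ((r + k : ℕ) : ℝ) lam κ := by
  have hh : 0 < hfun lam := by unfold hfun; positivity
  have hn' : (0 : ℝ) < n := by exact_mod_cast hn
  have hr' : (0 : ℝ) < r := by exact_mod_cast hr
  have hk' : (0 : ℝ) < k := by exact_mod_cast hk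
  obtain ⟨h1, h2, h3, h4⟩ := radius_spec (r * k) (Real.log 2) (n * hfun lam) (by positivity)
    (Real.log_pos (by norm_num)) (by positivity)
  set δ2 := radius (r * k) (Real.log 2) (n * hfun lam)
  have hsq : Real.sqrt δ2 ^ 2 = δ2 := Real.sq_sqrt h1
  set δ := Real.sqrt δ2
  let i0 : Fin k := ⟨0, hk⟩
  let sg : Fin 2 → ℝ := fun j => if j = 0 then δ else -δ
  have hsg : ∀ j, sg j ^ 2 = δ2 := by
    intro j; simp only [sg]; split_ifs <;> nlinarith
  have hsgd : ∀ j l, j ≠ l → (sg j - sg l) ^ 2 = 4 * δ2 := by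
    intro j l hjl
    fin_cases j <;> fin_cases l <;> simp_all [sg] <;> nlinarith
  let pos : Fin (k + l) → Fin r → Fin k × Fin r := fun a c =>
    (Fin.addCases (fun t => t) (fun _ => i0) a, c)
  let val : Fin (k + l) → Fin r → Fin 2 → ℝ := fun a c j =>
    Fin.addCases (fun _ => sg j) (fun _ => 0) a
  have hsumd : ∀ (i : Fin k × Fin r) j l, (∑ a, ∑ c, if pos a c = i then
      (val a c j - val a c l) ^ 2 else 0) = (sg j - sg l) ^ 2 := by
    rintro ⟨i, c0⟩ j l
    simp [Fin.sum_univ_add, pos, val, Prod.ext_iff, ite_and, Finset.sum_ite_eq']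
  have := family_bound (n := n) (m := k + l) (k := k) κ lam hκ hl (b := 2) le_rfl pos val δ2
    (r * k * δ2) ?_ ?_ ?_ ?_ ?_ h2 h1 (by exact_mod_cast h3)
  · refine le_trans ?_ this
    linarith
  · intro θ
    refine ⟨Finset.univ.image (Fin.castAdd l), Finset.card_image_le.trans (by simp), ?_⟩
    intro a c
    refine Fin.addCases (fun t _ => ?_) (fun t h => ?_) a
    · exact Finset.mem_image_of_mem _ (Finset.mem_univ _)
    · exact absurd (by simp [val]) h
  · intro i j l hjl
    rw [hsumd, hsgd j l hjl]; linarith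
  · intro i j l
    rw [hsumd]
    by_cases hjl : j = l
    · simp [hjl]; exact h1
    · rw [hsgd j l hjl]
  · intro θ
    simp [Fin.sum_univ_add, pos, val, hsg]
    apply le_of_eq; ring
  · rw [Fintype.card_prod, Fintype.card_fin, Fintype.card_fin]; push_cast; ring

lemma familyB {n l r k b : ℕ} (κ lam : ℝ) (hκ : 1 < κ) (hl : 0 < lam) (hn : 0 < n) (hr : 1 ≤ r)
    (hk : 1 ≤ k) (hb : 2 ≤ b) :
    1 / 13056 * min ((k : ℝ) * Real.log b / (n * hfun lam)) 1
      ≤ minimaxRisk 0 n (r + (k * b + l)) r ((r + k : ℕ) : ℝ) lam κ := by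
  have hh : 0 < hfun lam := by unfold hfun; positivity
  have hn' : (0 : ℝ) < n := by exact_mod_cast hn
  have hk' : (0 : ℝ) < k := by exact_mod_cast hk
  have hb' : (2 : ℝ) ≤ b := by exact_mod_cast hb
  obtain ⟨h1, h2, h3, h4⟩ := radius_spec k (Real.log b) (n * hfun lam) (by positivity)
    (Real.log_pos (by linarith)) (by positivity)
  set δ2 := radius k (Real.log b) (n * hfun lam)
  have hsq : Real.sqrt δ2 ^ 2 = δ2 := Real.sq_sqrt h1
  set δ := Real.sqrt δ2
  let i0 : Fin k := ⟨0, hk⟩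
  let c0 : Fin r := ⟨0, hr⟩
  let w : Fin b → Fin b → ℝ := fun t j => if t = j then δ else 0
  have hw : ∀ t j, w t j ^ 2 = if t = j then δ2 else 0 := by
    intro t j; simp only [w]; split_ifs <;> simp [hsq]
  let pos : Fin (k * b + l) → Fin r → Fin k := fun a c =>
    Fin.addCases (fun t => (finProdFinEquiv.symm t).1) (fun _ => i0) a
  let val : Fin (k * b + l) → Fin r → Fin b → ℝ := fun a c j =>
    Fin.addCases (fun t => if c = c0 then w (finProdFinEquiv.symm t).2 j else 0) (fun _ => 0) a
  have hre : ∀ f : Fin k × Fin b → ℝ, ∑ t : Fin (k * b), f (finProdFinEquiv.symm t)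
      = ∑ i, ∑ t, f (i, t) := by
    intro f
    rw [Equiv.sum_comp finProdFinEquiv.symm f, Fintype.sum_prod_type]
  have hcc : ∀ (g : ℝ → ℝ), g 0 = 0 → ∀ x y : ℝ, (∑ c : Fin r, g ((if c = c0 then x else 0) -
      (if c = c0 then y else 0))) = g (x - y) := by
    intro g hg x y
    rw [Finset.sum_eq_single c0]
    · simp
    · intro c _ hc; simp [hc, hg]
    · simp
  have hsumd : ∀ (i : Fin k) j l, (∑ a, ∑ c, if pos a c = i then
      (val a c j - val a c l) ^ 2 else 0) = ∑ t, (w t j - w t l) ^ 2 := by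
    intro i j l
    have e : ∀ a : Fin (k * b), (∑ c, if pos (Fin.castAdd _ a) c = i then
      (val (Fin.castAdd _ a) c j - val (Fin.castAdd _ a) c l) ^ 2 else 0)
      = (fun z : Fin k × Fin b => if z.1 = i then (w z.2 j - w z.2 l) ^ 2 else 0)
        (finProdFinEquiv.symm a) := by
      intro a
      simp only [pos, val, Fin.addCases_left]
      split_ifs with h
      · exact hcc (fun x => x ^ 2) (by simp) _ _
      · simp
    rw [Fin.sum_univ_add, Finset.sum_congr rfl fun a _ => e a, hre (fun z : Fin k × Fin b =>
      if z.1 = i then (w z.2 j - w z.2 l) ^ 2 else 0)]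
    simp [pos, val]
  have := family_bound (n := n) (m := k * b + l) (k := k) κ lam hκ hl hb pos val δ2
    (k * δ2) ?_ ?_ ?_ ?_ ?_ h2 h1 (by exact_mod_cast h3)
  · refine le_trans ?_ this
    linarith
  · intro θ
    refine ⟨Finset.univ.image (fun i : Fin k => Fin.castAdd l (finProdFinEquiv (i, θ i))),
      Finset.card_image_le.trans (by simp), ?_⟩
    intro a c
    refine Fin.addCases (fun t h => ?_) (fun t h => ?_) a
    · rw [Finset.mem_image]
      refine ⟨(finProdFinEquiv.symm t).1, Finset.mem_univ _, ?_⟩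
      have : (finProdFinEquiv.symm t).2 = θ (finProdFinEquiv.symm t).1 := by
        by_contra hne
        apply h
        simp only [pos, val, Fin.addCases_left, w, if_neg hne, ite_self]
      rw [← this, Prod.mk.eta, Equiv.apply_symm_apply]
    · exact absurd (by simp [val]) h
  · intro i j l hjl
    rw [hsumd]
    refine le_trans ?_ (Finset.single_le_sum (f := fun t => (w t j - w t l) ^ 2)
      (fun _ _ => sq_nonneg _) (Finset.mem_univ j))
    simp [w, hjl, hsq]
  · intro i j l
    rw [hsumd]
    calc ∑ t, (w t j - w t l) ^ 2 ≤ ∑ t, (2 * w t j ^ 2 + 2 * w t l ^ 2) :=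
          Finset.sum_le_sum fun t _ => by nlinarith [sq_nonneg (w t j + w t l)]
      _ = 4 * δ2 := by
          rw [Finset.sum_add_distrib, ← Finset.mul_sum, ← Finset.mul_sum]
          simp [hw]; ring
  · intro θ
    have e : ∀ a : Fin (k * b), (∑ c, (val (Fin.castAdd l a) c (θ (pos (Fin.castAdd l a) c))) ^ 2)
      = (fun z : Fin k × Fin b => w z.2 (θ z.1) ^ 2) (finProdFinEquiv.symm a) := by
      intro a
      simp only [pos, val, Fin.addCases_left]
      have := hcc (fun x => x ^ 2) (by simp)
        (w (finProdFinEquiv.symm a).2 (θ (finProdFinEquiv.symm a).1)) 0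
      simpa using this
    rw [Fin.sum_univ_add, Finset.sum_congr rfl fun a _ => e a, hre (fun z : Fin k × Fin b =>
      w z.2 (θ z.1) ^ 2)]
    simp [val, hw]
  · simp

/-! ### Final assembly -/

lemma min_comb (z x y α β : ℝ) (hx : 0 ≤ x) (hy : 0 ≤ y) (hα : 1 ≤ α) (hβ : 1 ≤ β)
    (hz : z ≤ α * x + β * y) : min z 1 ≤ α * min x 1 + β * min y 1 := by
  have hx' : 0 ≤ min x 1 := le_min hx zero_le_one
  have hy' : 0 ≤ min y 1 := le_min hy zero_le_one
  rcases le_total x 1 with h1 | h1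
  · rcases le_total y 1 with h2 | h2
    · rw [min_eq_left h1, min_eq_left h2]; exact (min_le_left _ _).trans hz
    · rw [min_eq_right h2]
      refine (min_le_right _ _).trans ?_
      nlinarith
  · rw [min_eq_right h1]
    refine (min_le_right _ _).trans ?_
    nlinarith

lemma lower_bound_core {n m r k : ℕ} (κ lam : ℝ) (hκ : 1 < κ) (hl : 0 < lam) (hn : 0 < n)
    (hr : 1 ≤ r) (hk : 1 ≤ k) (hkm : k ≤ m) :
    1 / 78336 * min (1 / ((n : ℝ) * hfun lam) *
        ((r : ℝ) * k + k * Real.log (Real.exp 1 * m / k))) 1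
      ≤ minimaxRisk 0 n (r + m) r ((r + k : ℕ) : ℝ) lam κ := by
  have hh : 0 < hfun lam := by unfold hfun; positivity
  have hn' : (0 : ℝ) < n := by exact_mod_cast hn
  have hr' : (1 : ℝ) ≤ r := by exact_mod_cast hr
  have hk' : (0 : ℝ) < k := by exact_mod_cast hk
  have hkm' : (k : ℝ) ≤ m := by exact_mod_cast hkm
  have hm' : (0 : ℝ) < m := by linarith
  have hlog2 := Real.log_two_gt_d9
  have hlog2' := Real.log_two_lt_d9
  have hA : 1 / 13056 * min ((r : ℝ) * k * Real.log 2 / (n * hfun lam)) 1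
      ≤ minimaxRisk 0 n (r + m) r ((r + k : ℕ) : ℝ) lam κ := by
    have := familyA (l := m - k) (n := n) (r := r) (k := k) κ lam hκ hl hn hr hk
    rwa [Nat.add_sub_cancel' hkm] at this
  set R := minimaxRisk 0 n (r + m) r ((r + k : ℕ) : ℝ) lam κ
  set u := (n : ℝ) * hfun lam with hu
  have hu0 : 0 < u := by positivity
  have hlog : Real.log (Real.exp 1 * m / k) = 1 + Real.log (m / k) := by
    rw [mul_div_assoc, Real.log_mul (Real.exp_pos _).ne' (by positivity), Real.log_exp]
  rw [hlog]
  have hmk0 : (0 : ℝ) < m / k := by positivity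
  have hrk : (0 : ℝ) ≤ r * k := by positivity
  have hkr : (k : ℝ) ≤ r * k := by nlinarith
  have hx : 0 ≤ (r : ℝ) * k * Real.log 2 / u := by positivity
  by_cases hcase : m < 2 * k
  · have h1 : Real.log (m / k) ≤ Real.log 2 := by
      refine Real.log_le_log hmk0 ?_
      rw [div_le_iff₀ hk']
      exact_mod_cast hcase.le
    have hz : 1 / u * ((r : ℝ) * k + k * (1 + Real.log (m / k)))
        ≤ 5 * ((r : ℝ) * k * Real.log 2 / u) + 1 * 0 := by
      have : (r : ℝ) * k + k * (1 + Real.log (m / k)) ≤ 5 * (r * k * Real.log 2) := by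
        have h2 : (k : ℝ) * (1 + Real.log (m / k)) ≤ k * 2 := by gcongr; linarith
        have h3 : (r : ℝ) * k * 0.69 ≤ r * k * Real.log 2 := by gcongr; linarith
        linarith
      calc _ ≤ 1 / u * (5 * (r * k * Real.log 2)) := by gcongr
        _ = _ := by ring
    have := min_comb _ _ _ _ _ hx le_rfl (by norm_num) le_rfl hz
    rw [min_eq_left (zero_le_one), mul_zero, add_zero] at this
    have h0 : 0 ≤ min ((r : ℝ) * k * Real.log 2 / u) 1 := le_min hx zero_le_one
    linarith
  · rw [not_lt] at hcase
    have hb : 2 ≤ m / k := (Nat.le_div_iff_mul_le hk).2 hcase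
    have hB : 1 / 13056 * min ((k : ℝ) * Real.log ((m / k : ℕ) : ℝ) / (n * hfun lam)) 1 ≤ R := by
      have := familyB (l := m % k) (n := n) (r := r) (k := k) κ lam hκ hl hn hr hk hb
      rwa [Nat.div_add_mod] at this
    rw [← hu] at hB
    set b := m / k with hbdef
    have hb' : (2 : ℝ) ≤ b := by exact_mod_cast hb
    have hmb : (m : ℝ) ≤ k * (b + 1) := by
      have h1 := Nat.div_add_mod m k
      rw [← hbdef] at h1
      have h2 := Nat.mod_lt m hk
      have : m ≤ k * (b + 1) := by rw [mul_add, mul_one]; omega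
      exact_mod_cast this
    have hlb : Real.log 2 ≤ Real.log b := Real.log_le_log (by norm_num) hb'
    have hlmk : Real.log (m / k) ≤ 2 * Real.log b := by
      have : Real.log (m / k) ≤ Real.log ((b : ℝ) ^ 2) := by
        refine Real.log_le_log hmk0 ?_
        rw [div_le_iff₀ hk']
        nlinarith
      rwa [Real.log_pow] at this
    have hy : 0 ≤ (k : ℝ) * Real.log b / u := by
      have : 0 ≤ Real.log b := by linarith
      positivity
    have hz : 1 / u * ((r : ℝ) * k + k * (1 + Real.log (m / k)))
        ≤ 2 * ((r : ℝ) * k * Real.log 2 / u) + 4 * ((k : ℝ) * Real.log b / u) := by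
      have : (r : ℝ) * k + k * (1 + Real.log (m / k))
          ≤ 2 * (r * k * Real.log 2) + 4 * (k * Real.log b) := by
        have h2 : (k : ℝ) * (1 + Real.log (m / k)) ≤ k * (4 * Real.log b) := by gcongr; linarith
        have h3 : (r : ℝ) * k * 0.69 ≤ r * k * Real.log 2 := by gcongr; linarith
        linarith
      calc _ ≤ 1 / u * (2 * (r * k * Real.log 2) + 4 * (k * Real.log b)) := by gcongr
        _ = _ := by ring
    have := min_comb _ _ _ _ _ hx hy (by norm_num) (by norm_num) hz
    linarith

/-- **Theorem 3** (lower bound, exact sparsity `q = 0`). -/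
theorem minimax_lower_bound_q0 :
    ∃ c : ℝ, 0 < c ∧
      ∀ (κ : ℝ), 1 < κ →
        ∀ (p s r n : ℕ) (lam : ℝ), 1 ≤ r → r ≤ s → s ≤ p → 0 < lam →
          c * min
              (1 / ((n : ℝ) * hfun lam) *
                ((r : ℝ) * ((s : ℝ) - r) +
                  ((s : ℝ) - r) *
                    Real.log (Real.exp 1 * ((p : ℝ) - r) / ((s : ℝ) - r))))
              1
            ≤ minimaxRisk 0 n p r s lam κ := by
  refine ⟨1 / 78336, by norm_num, ?_⟩
  intro κ hκ p s r n lam hr hrs hsp hl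
  obtain ⟨k, rfl⟩ := Nat.exists_eq_add_of_le hrs
  obtain ⟨m, rfl⟩ := Nat.exists_eq_add_of_le (hrs.trans hsp)
  have hkm : k ≤ m := by omega
  have e1 : ((r + k : ℕ) : ℝ) - r = k := by push_cast; ring
  have e2 : ((r + m : ℕ) : ℝ) - r = m := by push_cast; ring
  rw [e1, e2]
  have hR := minimax_nonneg 0 n (r + m) r ((r + k : ℕ) : ℝ) lam κ
  rcases Nat.eq_zero_or_pos n with rfl | hn
  · simpa using hR
  rcases Nat.eq_zero_or_pos k with rfl | hk
  · simpa using hR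
  exact lower_bound_core κ lam hκ hl hn hr hk hkm

end SparsePCA
end
end

section
/- Consider the orthogonal-design regression problem Y = Θ + E, where Θ ∈ ℝ^{p×r} is deterministic and E is a p×r matrix with i.i.d. N(0,1) entries. Let q ∈ [0,2) and s' > 0, and let F_q(s',p) = {Θ ∈ ℝ^{p×r} : ‖Θ‖_{q,w} ≤ s'}. Let t_k = r + √(2rβ·log(ep/k)) + β·log(ep/k), pen(k) = (1+δ)²·Σ_{i=1}^{k} t_i, and define the penalized least-squares estimator Θ̂ = argmin_{Θ ∈ ℝ^{p×r}} ‖Y − Θ‖_F² + pen(|supp(Θ)|), where supp(Θ) is the set of nonzero rows of Θ. If β > 2 and δ ∈ (0,1), then there exists a constant C depending only on q, β, δ such that sup_{Θ ∈ F_q(s',p)} E‖Θ̂ − Θ‖_F² ≤ C·k'·(r + log(ep/k')), where k' = min{k ∈ [p] : t_k^{q/2}·k ≥ s'}, with k' = p if this set is empty. -/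
open MeasureTheory ProbabilityTheory Matrix Real
open scoped BigOperators ENNReal NNReal

noncomputable section

namespace SparsePCA

/-- `t_k = r + √(2 r β log(ep/k)) + β log(ep/k)`. -/
def tpen (β : ℝ) (p r : ℕ) (k : ℕ) : ℝ :=
  (r : ℝ) + Real.sqrt (2 * r * β * Real.log (Real.exp 1 * p / k)) +
    β * Real.log (Real.exp 1 * p / k)

/-- The penalty `pen(k) = (1+δ)² ∑_{i=1}^k t_i`. -/
def pen (β δ : ℝ) (p r : ℕ) (k : ℕ) : ℝ :=
  (1 + δ) ^ 2 * ∑ i ∈ Finset.Icc 1 k, tpen β p r i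

/-- Number of nonzero rows of a matrix. -/
def suppCard {p r : ℕ} (T : Matrix (Fin p) (Fin r) ℝ) : ℕ :=
  Nat.card {j : Fin p // T j ≠ 0}

/-- The penalized least-squares estimator
`Θ̂ = argmin_Θ ‖Y - Θ‖_F² + pen(|supp(Θ)|)`. -/
noncomputable def penEst (β δ : ℝ) {p r : ℕ} (Y : Matrix (Fin p) (Fin r) ℝ) :
    Matrix (Fin p) (Fin r) ℝ :=
  Classical.epsilon fun T : Matrix (Fin p) (Fin r) ℝ =>
    ∀ T' : Matrix (Fin p) (Fin r) ℝ,
      frobSq (Y - T) + pen β δ p r (suppCard T) ≤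
        frobSq (Y - T') + pen β δ p r (suppCard T')

open Classical in
/-- `k' = min{k ∈ [p] : t_k^{q/2} k ≥ s'}`, set to `p` if no such `k` exists. -/
noncomputable def kprime (q β s' : ℝ) (p r : ℕ) : ℕ :=
  if (∃ k, 1 ≤ k ∧ k ≤ p ∧ s' ≤ tpen β p r k ^ (q / 2) * k) then
    sInf {k : ℕ | 1 ≤ k ∧ k ≤ p ∧ s' ≤ tpen β p r k ^ (q / 2) * k}
  else p

/-! ### Probabilistic part -/

lemma aux_gauss_integral (lam : ℝ) (hl : lam < 1 / 2) :
    ∫ x, Real.exp (lam * x ^ 2) ∂(gaussianReal 0 1) = (Real.sqrt (1 - 2 * lam))⁻¹ := by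
  rw [integral_gaussianReal_eq_integral_smul one_ne_zero]
  have h : ∀ x : ℝ, gaussianPDFReal 0 1 x • Real.exp (lam * x ^ 2) =
      (Real.sqrt (2 * Real.pi))⁻¹ * Real.exp (-((1 - 2 * lam) / 2) * x ^ 2) := by
    intro x
    simp only [gaussianPDFReal, smul_eq_mul, NNReal.coe_one, mul_one, sub_zero]
    rw [mul_assoc, ← Real.exp_add]
    congr 2
    ring
  simp_rw [h]
  rw [integral_const_mul, integral_gaussian]
  have h1 : 0 < 1 - 2 * lam := by linarith
  have h2 : Real.pi / ((1 - 2 * lam) / 2) = (2 * Real.pi) * (1 - 2 * lam)⁻¹ := by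
    field_simp
  rw [h2, Real.sqrt_mul (show 0 ≤ 2 * Real.pi by positivity) (1 - 2 * lam)⁻¹, Real.sqrt_inv, ← mul_assoc, inv_mul_cancel₀, one_mul]
  positivity

lemma aux_gauss_integrable (lam : ℝ) (hl : lam < 1 / 2) :
    Integrable (fun x => Real.exp (lam * x ^ 2)) (gaussianReal 0 1) := by
  apply Integrable.of_integral_ne_zero
  rw [aux_gauss_integral lam hl]
  have h1 : 0 < 1 - 2 * lam := by linarith
  positivity

instance aux_isProb_std (m : ℕ) : IsProbabilityMeasure (stdGaussian (Fin m)) := by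
  unfold stdGaussian; infer_instance

instance aux_isProb_mat (n m : ℕ) : IsProbabilityMeasure (gaussianMatrix n m) := by
  unfold gaussianMatrix; infer_instance

lemma aux_row_integral (r : ℕ) (lam : ℝ) (hl : lam < 1 / 2) :
    ∫ x, Real.exp (lam * ∑ k, (x k) ^ 2) ∂(stdGaussian (Fin r)) =
      ((Real.sqrt (1 - 2 * lam))⁻¹) ^ r := by
  simp_rw [Finset.mul_sum, Real.exp_sum]
  unfold stdGaussian
  rw [integral_fintype_prod_eq_prod (fun (_ : Fin r) (y : ℝ) => Real.exp (lam * y ^ 2))]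
  simp [aux_gauss_integral lam hl]

lemma aux_row_integrable (r : ℕ) (lam : ℝ) (hl : lam < 1 / 2) :
    Integrable (fun x : Fin r → ℝ => Real.exp (lam * ∑ k, (x k) ^ 2)) (stdGaussian (Fin r)) := by
  simp_rw [Finset.mul_sum, Real.exp_sum]
  unfold stdGaussian
  exact Integrable.fintype_prod (f := fun (_ : Fin r) (y : ℝ) => Real.exp (lam * y ^ 2))
    (fun _ => aux_gauss_integrable lam hl)

/-- squared norm of a row of the noise -/
def rowSq {p r : ℕ} (z : Fin p → Fin r → ℝ) (j : Fin p) : ℝ := ∑ k, (z j k) ^ 2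

lemma aux_exp_eq_prod {p r : ℕ} (lam : ℝ) (B : Finset (Fin p)) (z : Fin p → Fin r → ℝ) :
    Real.exp (lam * ∑ j ∈ B, rowSq z j) =
      ∏ j, (fun (j : Fin p) (x : Fin r → ℝ) =>
        if j ∈ B then Real.exp (lam * ∑ k, (x k) ^ 2) else 1) j (z j) := by
  rw [Finset.mul_sum, Real.exp_sum]
  simp [rowSq, Finset.prod_ite_mem]

lemma aux_mat_integral (p r : ℕ) (lam : ℝ) (hl : lam < 1 / 2) (B : Finset (Fin p)) :
    ∫ z, Real.exp (lam * ∑ j ∈ B, rowSq z j) ∂(gaussianMatrix p r) =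
      (((Real.sqrt (1 - 2 * lam))⁻¹) ^ r) ^ B.card := by
  simp_rw [aux_exp_eq_prod]
  unfold gaussianMatrix
  rw [integral_fintype_prod_eq_prod (fun (j : Fin p) (x : Fin r → ℝ) =>
        if j ∈ B then Real.exp (lam * ∑ k, (x k) ^ 2) else 1)]
  have : ∀ j : Fin p, (∫ x, (if j ∈ B then Real.exp (lam * ∑ k, (x k) ^ 2) else 1)
      ∂(stdGaussian (Fin r))) = if j ∈ B then ((Real.sqrt (1 - 2 * lam))⁻¹) ^ r else 1 := by
    intro j
    split_ifs
    · exact aux_row_integral r lam hl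
    · simp
  simp_rw [this]
  rw [Finset.prod_ite_mem]
  simp

lemma aux_mat_integrable (p r : ℕ) (lam : ℝ) (hl : lam < 1 / 2) (B : Finset (Fin p)) :
    Integrable (fun z => Real.exp (lam * ∑ j ∈ B, rowSq z j)) (gaussianMatrix p r) := by
  simp_rw [aux_exp_eq_prod]
  unfold gaussianMatrix
  apply Integrable.fintype_prod (f := fun (j : Fin p) (x : Fin r → ℝ) =>
        if j ∈ B then Real.exp (lam * ∑ k, (x k) ^ 2) else 1)
  intro j
  by_cases h : j ∈ B
  · simpa [h] using aux_row_integrable r lam hl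
  · simp [h]

lemma aux_log_le (w : ℝ) (hw : 1 ≤ w) : Real.log w ≤ (w - w⁻¹) / 2 := by
  have h := Real.self_le_sinh_iff.2 (Real.log_nonneg hw)
  have hw0 : 0 < w := by linarith
  rwa [Real.sinh_eq, Real.exp_neg, Real.exp_log hw0] at h

/-- the optimal exponent -/
def lamx (r : ℕ) (x : ℝ) : ℝ := Real.sqrt x / (Real.sqrt r + 2 * Real.sqrt x)

lemma lamx_lt (r : ℕ) (hr : 0 < r) (x : ℝ) (hx : 0 < x) : lamx r x < 1 / 2 := by
  unfold lamx
  have hu := Real.sqrt_pos.2 hx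
  have hv : 0 < Real.sqrt (r : ℝ) := Real.sqrt_pos.2 (by exact_mod_cast hr)
  rw [div_lt_div_iff₀ (by positivity) (by norm_num)]
  linarith

lemma lamx_pos (r : ℕ) (x : ℝ) (hx : 0 < x) : 0 < lamx r x := by
  unfold lamx
  have hu := Real.sqrt_pos.2 hx
  positivity

lemma lamx_inv_le (r : ℕ) (x : ℝ) (hx : 1 ≤ x) : (lamx r x)⁻¹ ≤ 2 + r := by
  unfold lamx
  have hu : 1 ≤ Real.sqrt x := by rw [Real.one_le_sqrt]; exact hx
  rw [inv_div, div_le_iff₀ (by linarith)]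
  have : Real.sqrt (r : ℝ) ≤ r := by
    rcases Nat.eq_zero_or_pos r with h | h
    · simp [h]
    · have h1 : (1 : ℝ) ≤ r := by exact_mod_cast h
      rw [Real.sqrt_le_left (by linarith)]
      nlinarith
  nlinarith [Nat.cast_nonneg (α := ℝ) r]

lemma aux_chernoff (r : ℕ) (hr : 0 < r) (x : ℝ) (hx : 0 < x) :
    ((Real.sqrt (1 - 2 * lamx r x))⁻¹) ^ r *
      Real.exp (-(lamx r x * (r + 2 * Real.sqrt (r * x) + 2 * x))) ≤ Real.exp (-x) := by
  have hu := Real.sqrt_pos.2 hx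
  have hr' : (0 : ℝ) < r := by exact_mod_cast hr
  have hv : 0 < Real.sqrt (r : ℝ) := Real.sqrt_pos.2 hr'
  have hxu : x = Real.sqrt x ^ 2 := (Real.sq_sqrt hx.le).symm
  have hrv : (r : ℝ) = Real.sqrt r ^ 2 := (Real.sq_sqrt hr'.le).symm
  have h1 : 1 - 2 * lamx r x = (1 + 2 * Real.sqrt x / Real.sqrt r)⁻¹ := by
    unfold lamx
    field_simp
    ring
  set w := 1 + 2 * Real.sqrt x / Real.sqrt r with hw
  have hw1 : 1 ≤ w := by
    have : 0 ≤ 2 * Real.sqrt x / Real.sqrt r := by positivity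
    linarith
  have hw0 : 0 < w := by linarith
  have h2 : ((Real.sqrt (1 - 2 * lamx r x))⁻¹) ^ r = Real.exp (r * (Real.log w / 2)) := by
    rw [h1, Real.sqrt_inv, inv_inv, Real.exp_nat_mul]
    congr 1
    rw [← Real.log_sqrt hw0.le, Real.exp_log (Real.sqrt_pos.2 hw0)]
  rw [h2, ← Real.exp_add, Real.exp_le_exp]
  have h3 : (r : ℝ) * (Real.log w / 2) ≤ r * ((w - w⁻¹) / 2 / 2) := by
    have := aux_log_le w hw1
    gcongr
  have h4 : (r : ℝ) * ((w - w⁻¹) / 2 / 2) =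
      lamx r x * (r + 2 * Real.sqrt (r * x) + 2 * x) - x := by
    rw [Real.sqrt_mul hr'.le]
    unfold lamx
    rw [hw]
    generalize Real.sqrt x = u at *
    generalize Real.sqrt (r : ℝ) = v at *
    rw [hxu, hrv]
    have : v + 2 * u ≠ 0 := by positivity
    have e : (1 + 2 * u / v) = (v + 2 * u) / v := by field_simp
    rw [e, inv_div]
    field_simp
    ring
  linarith

lemma aux_choose_le (p i : ℕ) (hi : 0 < i) :
    (p.choose i : ℝ) ≤ (Real.exp 1 * p / i) ^ i := by
  have h1 := Nat.choose_le_pow_div (α := ℝ) i p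
  have h2 := Real.pow_div_factorial_le_exp (i : ℝ) (by positivity) i
  have hi' : (0 : ℝ) < i := by exact_mod_cast hi
  refine h1.trans ?_
  have h3 : (Real.exp 1 * p / i) ^ i = Real.exp i * p ^ i / (i : ℝ) ^ i := by
    rw [div_pow, mul_pow, ← Real.exp_nat_mul, mul_one]
  rw [h3, div_le_div_iff₀ (by positivity) (by positivity)]
  rw [div_le_iff₀ (by positivity)] at h2
  nlinarith [mul_le_mul_of_nonneg_left h2 (show (0 : ℝ) ≤ (p : ℝ) ^ i by positivity)]

/-- `log (e p / k)` -/
def Lk (p k : ℕ) : ℝ := Real.log (Real.exp 1 * p / k)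

lemma Lk_ge (p k : ℕ) (hk : 0 < k) (hkp : k ≤ p) : 1 ≤ Lk p k := by
  unfold Lk
  have hk' : (0 : ℝ) < k := by exact_mod_cast hk
  have hkp' : (k : ℝ) ≤ p := by exact_mod_cast hkp
  rw [Real.le_log_iff_exp_le (by have : (0 : ℝ) < p := by linarith
                                 positivity)]
  rw [le_div_iff₀ hk']
  gcongr

lemma tpen_eq (β : ℝ) (hβ : 2 < β) (p r k : ℕ) :
    tpen β p r k = r + 2 * Real.sqrt (r * (β / 2 * Lk p k)) + 2 * (β / 2 * Lk p k) := by
  unfold tpen Lk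
  have : 2 * (r : ℝ) * β * Real.log (Real.exp 1 * p / k) =
    2 ^ 2 * (r * (β / 2 * Real.log (Real.exp 1 * p / k))) := by ring
  rw [this, Real.sqrt_mul (by positivity), Real.sqrt_sq (by norm_num)]
  ring

/-- excess term -/
def Gk (β : ℝ) {p r : ℕ} (i : ℕ) (z : Fin p → Fin r → ℝ) : ℝ :=
  ∑ B ∈ Finset.powersetCard i (Finset.univ : Finset (Fin p)),
    Real.exp (lamx r (β / 2 * Lk p i) * ∑ j ∈ B, rowSq z j) *
      (Real.exp (-(lamx r (β / 2 * Lk p i) * tpen β p r i)) ^ i /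
        (lamx r (β / 2 * Lk p i) * i))

lemma Gk_nonneg (β : ℝ) (hβ : 2 < β) {p r : ℕ} (i : ℕ) (hi : 0 < i) (hip : i ≤ p)
    (z : Fin p → Fin r → ℝ) : 0 ≤ Gk β i z := by
  have hx : 0 < β / 2 * Lk p i := by nlinarith [Lk_ge p i hi hip]
  have := lamx_pos r _ hx
  unfold Gk
  positivity

lemma Gk_integrable (β : ℝ) (hβ : 2 < β) {p r : ℕ} (hr : 0 < r) (i : ℕ) (hi : 0 < i)
    (hip : i ≤ p) : Integrable (fun z => Gk β (p := p) (r := r) i z) (gaussianMatrix p r) := by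
  have hx : 0 < β / 2 * Lk p i := by nlinarith [Lk_ge p i hi hip]
  unfold Gk
  apply integrable_finsetSum
  intro B _
  exact (aux_mat_integrable p r _ (lamx_lt r hr _ hx) B).mul_const _

lemma Gk_integral (β : ℝ) (hβ : 2 < β) {p r : ℕ} (hr : 0 < r) (i : ℕ) (hi : 0 < i)
    (hip : i ≤ p) : ∫ z, Gk β (p := p) (r := r) i z ∂(gaussianMatrix p r) ≤
      (2 + r) * Real.exp (-(β / 2 - 1)) ^ i := by
  have hL := Lk_ge p i hi hip
  have hx : 0 < β / 2 * Lk p i := by nlinarith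
  have hx1 : 1 ≤ β / 2 * Lk p i := by nlinarith
  have hl := lamx_pos r _ hx
  have hl2 := lamx_lt r hr _ hx
  have hch := aux_chernoff r hr _ hx
  rw [← tpen_eq β hβ] at hch
  have hinv := lamx_inv_le r _ hx1
  have hcho := aux_choose_le p i hi
  unfold Gk
  rw [integral_finsetSum _
    (fun B _ => (aux_mat_integrable p r _ hl2 B).mul_const _)]
  simp_rw [integral_mul_const, aux_mat_integral p r _ hl2]
  rw [Finset.sum_congr rfl (g := fun _ =>
    (((Real.sqrt (1 - 2 * lamx r (β / 2 * Lk p i)))⁻¹) ^ r) ^ i *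
      (Real.exp (-(lamx r (β / 2 * Lk p i) * tpen β p r i)) ^ i /
        (lamx r (β / 2 * Lk p i) * i)))
    (fun B hB => by rw [(Finset.mem_powersetCard.1 hB).2])]
  rw [Finset.sum_const, Finset.card_powersetCard, Finset.card_univ, Fintype.card_fin, nsmul_eq_mul]
  set lam := lamx r (β / 2 * Lk p i) with hlam
  set M := ((Real.sqrt (1 - 2 * lam))⁻¹) ^ r with hM
  have hM0 : 0 ≤ M := by positivity
  have hi1 : (1 : ℝ) ≤ i := by exact_mod_cast hi
  have hpi : Real.exp 1 * p / i = Real.exp (Lk p i) := by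
    unfold Lk
    rw [Real.exp_log]
    have : (0 : ℝ) < p := by exact_mod_cast lt_of_lt_of_le hi hip
    positivity
  rw [hpi] at hcho
  have e1 : M ^ i * (Real.exp (-(lam * tpen β p r i)) ^ i / (lam * i)) =
      (M * Real.exp (-(lam * tpen β p r i))) ^ i * (lam⁻¹ * (i : ℝ)⁻¹) := by
    rw [mul_pow, div_eq_mul_inv, mul_inv, mul_assoc]
  rw [e1]
  have e2 : lam⁻¹ * (i : ℝ)⁻¹ ≤ (2 + r) := by
    have h1 : (i : ℝ)⁻¹ ≤ 1 := inv_le_one_of_one_le₀ hi1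
    have h2 : 0 ≤ lam⁻¹ := by positivity
    nlinarith
  have e3 : (M * Real.exp (-(lam * tpen β p r i))) ^ i ≤ Real.exp (-(β / 2 * Lk p i)) ^ i := by
    gcongr
  have e4 : Real.exp (Lk p i) ^ i * Real.exp (-(β / 2 * Lk p i)) ^ i ≤
      Real.exp (-(β / 2 - 1)) ^ i := by
    rw [← mul_pow, ← Real.exp_add]
    gcongr
    nlinarith
  calc (p.choose i : ℝ) * ((M * Real.exp (-(lam * tpen β p r i))) ^ i * (lam⁻¹ * (i : ℝ)⁻¹))
      ≤ Real.exp (Lk p i) ^ i * (Real.exp (-(β / 2 * Lk p i)) ^ i * (2 + r)) := by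
        gcongr
    _ = (2 + r) * (Real.exp (Lk p i) ^ i * Real.exp (-(β / 2 * Lk p i)) ^ i) := by ring
    _ ≤ _ := by gcongr

/-- total excess -/
def Rk (β : ℝ) {p r : ℕ} (z : Fin p → Fin r → ℝ) : ℝ := ∑ i ∈ Finset.Icc 1 p, Gk β i z

lemma Rk_integrable (β : ℝ) (hβ : 2 < β) {p r : ℕ} (hr : 0 < r) :
    Integrable (fun z => Rk β (p := p) (r := r) z) (gaussianMatrix p r) := by
  unfold Rk
  apply integrable_finsetSum
  intro i hi
  rw [Finset.mem_Icc] at hi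
  exact Gk_integrable β hβ hr i hi.1 hi.2

lemma Rk_integral (β : ℝ) (hβ : 2 < β) {p r : ℕ} (hr : 0 < r) :
    ∫ z, Rk β (p := p) (r := r) z ∂(gaussianMatrix p r) ≤
      (2 + r) * (1 - Real.exp (-(β / 2 - 1)))⁻¹ := by
  unfold Rk
  rw [integral_finsetSum _ (fun i hi => Gk_integrable β hβ hr i (Finset.mem_Icc.1 hi).1
    (Finset.mem_Icc.1 hi).2)]
  have ha1 : Real.exp (-(β / 2 - 1)) < 1 := by
    rw [Real.exp_lt_one_iff]; linarith
  have ha0 := Real.exp_pos (-(β / 2 - 1))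
  set a := Real.exp (-(β / 2 - 1))
  calc _ ≤ ∑ i ∈ Finset.Icc 1 p, (2 + (r : ℝ)) * a ^ i :=
        Finset.sum_le_sum (fun i hi => Gk_integral β hβ hr i (Finset.mem_Icc.1 hi).1
          (Finset.mem_Icc.1 hi).2)
    _ = (2 + (r : ℝ)) * ∑ i ∈ Finset.Ico 1 (p + 1), a ^ i := by
        rw [Finset.mul_sum]; rfl
    _ ≤ (2 + (r : ℝ)) * (1 - a)⁻¹ := by
        have h := geom_sum_Ico_le_of_lt_one (m := 1) (n := p + 1) ha0.le ha1
        have h2 : a ^ 1 / (1 - a) ≤ (1 - a)⁻¹ := by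
          rw [pow_one, div_eq_mul_inv]
          have : 0 < (1 - a)⁻¹ := inv_pos.2 (by linarith)
          nlinarith
        gcongr
        exact h.trans h2

lemma Rk_step (β : ℝ) (hβ : 2 < β) {p r : ℕ} (z : Fin p → Fin r → ℝ) (n : ℕ) :
    ∀ A : Finset (Fin p), A.card = n →
      ∑ j ∈ A, rowSq z j ≤ ∑ i ∈ Finset.Icc 1 n, (tpen β p r i + Gk β i z) := by
  induction n with
  | zero =>
    intro A hA
    rw [Finset.card_eq_zero] at hA
    simp [hA]
  | succ n ih =>
    intro A hA
    have hne : A.Nonempty := by rw [← Finset.card_pos]; omega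
    obtain ⟨m, hm, hmin⟩ := Finset.exists_min_image A (rowSq z) hne
    have hA' : (A.erase m).card = n := by rw [Finset.card_erase_of_mem hm]; omega
    have h1 := ih _ hA'
    rw [← Finset.add_sum_erase A _ hm, ← Finset.insert_Icc_right_eq_Icc_add_one (by omega),
      Finset.sum_insert (by simp)]
    have hip : n + 1 ≤ p := by
      rw [← hA]; simpa using Finset.card_le_univ A
    have hL := Lk_ge p (n + 1) (by omega) hip
    have hx : 0 < β / 2 * Lk p (n + 1) := by nlinarith
    have hl := lamx_pos r _ hx
    suffices hs : rowSq z m - tpen β p r (n + 1) ≤ Gk β (n + 1) z by linarith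
    have hG : Real.exp (lamx r (β / 2 * Lk p (n + 1)) * ∑ j ∈ A, rowSq z j) *
      (Real.exp (-(lamx r (β / 2 * Lk p (n + 1)) * tpen β p r (n + 1))) ^ (n + 1) /
        (lamx r (β / 2 * Lk p (n + 1)) * (n + 1 : ℕ))) ≤ Gk β (n + 1) z := by
      unfold Gk
      apply Finset.single_le_sum (f := fun B : Finset (Fin p) =>
        Real.exp (lamx r (β / 2 * Lk p (n + 1)) * ∑ j ∈ B, rowSq z j) *
      (Real.exp (-(lamx r (β / 2 * Lk p (n + 1)) * tpen β p r (n + 1))) ^ (n + 1) /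
        (lamx r (β / 2 * Lk p (n + 1)) * (n + 1 : ℕ))))
      · intro B _
        positivity
      · rw [Finset.mem_powersetCard]
        exact ⟨Finset.subset_univ _, hA⟩
    refine le_trans ?_ hG
    set lam := lamx r (β / 2 * Lk p (n + 1))
    set t := tpen β p r (n + 1)
    have hc : ((n + 1 : ℕ) : ℝ) * rowSq z m ≤ ∑ j ∈ A, rowSq z j := by
      have := Finset.card_nsmul_le_sum A (rowSq z) (rowSq z m) hmin
      rwa [hA, nsmul_eq_mul] at this
    rw [← Real.exp_nat_mul, ← mul_div_assoc, ← Real.exp_add,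
      le_div_iff₀ (by positivity)]
    have h5 := Real.add_one_le_exp (lam * ∑ j ∈ A, rowSq z j + ((n + 1 : ℕ) : ℝ) * -(lam * t))
    nlinarith [mul_le_mul_of_nonneg_left hc hl.le]

lemma Rk_bound (β : ℝ) (hβ : 2 < β) {p r : ℕ} (z : Fin p → Fin r → ℝ) (A : Finset (Fin p)) :
    ∑ j ∈ A, rowSq z j ≤ ∑ i ∈ Finset.Icc 1 A.card, tpen β p r i + Rk β z := by
  have h := Rk_step β hβ z A.card A rfl
  rw [Finset.sum_add_distrib] at h
  have hAp : A.card ≤ p := by simpa using Finset.card_le_univ A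
  have : ∑ i ∈ Finset.Icc 1 A.card, Gk β i z ≤ Rk β z := by
    unfold Rk
    apply Finset.sum_le_sum_of_subset_of_nonneg (Finset.Icc_subset_Icc_right hAp)
    intro i hi _
    rw [Finset.mem_Icc] at hi
    exact Gk_nonneg β hβ i hi.1 hi.2 z
  linarith

/-! ### Deterministic part -/

lemma tpen_nonneg (β : ℝ) (hβ : 2 < β) (p r k : ℕ) (hk : 0 < k) (hkp : k ≤ p) :
    0 ≤ tpen β p r k := by
  rw [tpen_eq β hβ]
  have := Lk_ge p k hk hkp
  positivity

lemma tpen_le (β : ℝ) (hβ : 2 < β) (p r k : ℕ) (hk : 0 < k) (hkp : k ≤ p) :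
    tpen β p r k ≤ 2 * β * (r + Lk p k) := by
  rw [tpen_eq β hβ]
  have hL := Lk_ge p k hk hkp
  have hx : 0 ≤ β / 2 * Lk p k := by positivity
  have hr : (0 : ℝ) ≤ r := Nat.cast_nonneg r
  rw [Real.sqrt_mul hr]
  have h1 := Real.sq_sqrt hx
  have h2 := Real.sq_sqrt hr
  nlinarith [sq_nonneg (Real.sqrt (r : ℝ) - Real.sqrt (β / 2 * Lk p k))]

lemma aux_sum_Lk (p k : ℕ) (hk : 0 < k) (hkp : k ≤ p) :
    ∑ i ∈ Finset.Icc 1 k, Lk p i ≤ k * (Lk p k + 1) := by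
  have hp : (0 : ℝ) < p := by exact_mod_cast lt_of_lt_of_le hk hkp
  have hk' : (0 : ℝ) < k := by exact_mod_cast hk
  have hlog : ∀ i : ℕ, 0 < i → Lk p i = Real.log (Real.exp 1 * p) - Real.log i := by
    intro i hi
    have : (0 : ℝ) < i := by exact_mod_cast hi
    unfold Lk
    rw [Real.log_div (by positivity) (by positivity)]
  have h1 : ∀ n : ℕ, ∑ i ∈ Finset.Icc 1 n, Lk p i =
      n * Real.log (Real.exp 1 * p) - Real.log (n.factorial) := by
    intro n
    induction n with
    | zero => simp
    | succ n ih =>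
      rw [← Finset.insert_Icc_right_eq_Icc_add_one (by omega), Finset.sum_insert (by simp), ih,
        hlog _ (by omega), Nat.factorial_succ, Nat.cast_mul,
        Real.log_mul (x := ((n + 1 : ℕ) : ℝ)) (y := (n.factorial : ℝ)) (by positivity)
        (by positivity)]
      push_cast
      ring
  rw [h1, hlog k hk]
  have h2 := Real.pow_div_factorial_le_exp (k : ℝ) hk'.le k
  have h3 : k * Real.log k - Real.log (k.factorial) ≤ k := by
    rw [← Real.log_pow, ← Real.log_div (by positivity) (by positivity)]
    rw [Real.log_le_iff_le_exp (by positivity)]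
    exact h2
  linarith

lemma aux_sum_tpen (β : ℝ) (hβ : 2 < β) (p r k : ℕ) (hk : 0 < k) (hkp : k ≤ p) :
    ∑ i ∈ Finset.Icc 1 k, tpen β p r i ≤ 4 * β * (k * (r + Lk p k)) := by
  have h1 : ∑ i ∈ Finset.Icc 1 k, tpen β p r i ≤
      ∑ i ∈ Finset.Icc 1 k, 2 * β * (r + Lk p i) :=
    Finset.sum_le_sum (fun i hi => tpen_le β hβ p r i (Finset.mem_Icc.1 hi).1
      ((Finset.mem_Icc.1 hi).2.trans hkp))
  rw [← Finset.mul_sum, Finset.sum_add_distrib] at h1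
  simp only [Finset.sum_const, Nat.card_Icc, nsmul_eq_mul, Nat.add_sub_cancel] at h1
  have h2 := aux_sum_Lk p k hk hkp
  have hL := Lk_ge p k hk hkp
  have hk' : (0 : ℝ) < k := by exact_mod_cast hk
  have hr : (0 : ℝ) ≤ r := Nat.cast_nonneg r
  refine h1.trans ?_
  have h3 : (k : ℝ) * r + ∑ i ∈ Finset.Icc 1 k, Lk p i ≤ 2 * (k * (r + Lk p k)) := by
    nlinarith [mul_nonneg hk'.le hr]
  calc _ ≤ 2 * β * (2 * (k * (r + Lk p k))) := by gcongr
    _ = _ := by ring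

lemma pen_mono (β δ : ℝ) (hβ : 2 < β) (p r k l : ℕ) (hkl : k ≤ l) (hl : l ≤ p) :
    pen β δ p r k ≤ pen β δ p r l := by
  unfold pen
  gcongr ?_ * ?_
  apply Finset.sum_le_sum_of_subset_of_nonneg (Finset.Icc_subset_Icc_right hkl)
  intro i hi _
  rw [Finset.mem_Icc] at hi
  exact tpen_nonneg β hβ p r i hi.1 (hi.2.trans hl)

open Classical in
/-- support of a matrix as a finset -/
def suppF {p r : ℕ} (T : Matrix (Fin p) (Fin r) ℝ) : Finset (Fin p) :=
  Finset.univ.filter (fun j => T j ≠ 0)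

lemma suppCard_eq {p r : ℕ} (T : Matrix (Fin p) (Fin r) ℝ) : suppCard T = (suppF T).card := by
  classical
  unfold suppCard suppF
  rw [Nat.card_eq_fintype_card, Fintype.card_subtype]

/-- restriction of a matrix to rows in `A` -/
def restr {p r : ℕ} (Y : Matrix (Fin p) (Fin r) ℝ) (A : Finset (Fin p)) :
    Matrix (Fin p) (Fin r) ℝ := fun j k => if j ∈ A then Y j k else 0

lemma suppCard_restr {p r : ℕ} (Y : Matrix (Fin p) (Fin r) ℝ) (A : Finset (Fin p)) :
    suppCard (restr Y A) ≤ A.card := by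
  rw [suppCard_eq]
  apply Finset.card_le_card
  intro j hj
  by_contra h
  simp only [suppF, Finset.mem_filter, Finset.mem_univ, true_and] at hj
  exact hj (by ext k; simp [restr, h])

lemma card_le_p {p : ℕ} (A : Finset (Fin p)) : A.card ≤ p := by
  simpa using Finset.card_le_univ A

lemma penEst_spec (β δ : ℝ) (hβ : 2 < β) {p r : ℕ} (Y T' : Matrix (Fin p) (Fin r) ℝ) :
    frobSq (Y - penEst β δ Y) + pen β δ p r (suppCard (penEst β δ Y)) ≤
      frobSq (Y - T') + pen β δ p r (suppCard T') := by
  have hex : ∃ T : Matrix (Fin p) (Fin r) ℝ, ∀ T' : Matrix (Fin p) (Fin r) ℝ,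
      frobSq (Y - T) + pen β δ p r (suppCard T) ≤
        frobSq (Y - T') + pen β δ p r (suppCard T') := by
    obtain ⟨A, -, hA⟩ := Finset.exists_min_image (Finset.univ : Finset (Finset (Fin p)))
      (fun A => frobSq (Y - restr Y A) + pen β δ p r A.card) ⟨∅, Finset.mem_univ _⟩
    refine ⟨restr Y A, fun T' => ?_⟩
    have h1 := hA (suppF T') (Finset.mem_univ _)
    have h2 := pen_mono β δ hβ p r _ _ (suppCard_restr Y A) (card_le_p A)
    have h3 : frobSq (Y - restr Y (suppF T')) ≤ frobSq (Y - T') := by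
      unfold frobSq
      apply Finset.sum_le_sum
      intro i _
      apply Finset.sum_le_sum
      intro j _
      simp only [Matrix.sub_apply, restr]
      split_ifs with h
      · rw [sub_self, zero_pow two_ne_zero]
        positivity
      · simp only [suppF, Finset.mem_filter, Finset.mem_univ, true_and, not_not] at h
        rw [h]
        simp
    rw [suppCard_eq T']
    linarith
  exact Classical.epsilon_spec hex T'

lemma aux_entry (δ h t θ z : ℝ) (hδ : 0 < δ) :
    δ / (2 * (1 + δ)) * (h - θ) ^ 2 ≤
      (θ + z - h) ^ 2 - (θ + z - t) ^ 2 + (1 + (1 + 2 / δ) / (1 + δ)) * (θ - t) ^ 2 +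
      (1 + δ) * z ^ 2 := by
  have e : ∀ x y : ℝ, x ^ 2 / δ ≥ 0 := fun x y => by positivity
  have h1 : 2 * z * (h - t) ≤ (1 + δ) * z ^ 2 + (1 + δ)⁻¹ * (h - t) ^ 2 := by
    have : (1 + δ) * z ^ 2 + (1 + δ)⁻¹ * (h - t) ^ 2 - 2 * z * (h - t) =
      (1 + δ)⁻¹ * ((1 + δ) * z - (h - t)) ^ 2 := by field_simp; ring
    have h2 : 0 ≤ (1 + δ)⁻¹ * ((1 + δ) * z - (h - t)) ^ 2 := by positivity
    linarith
  have h2 : (h - t) ^ 2 ≤ (1 + δ / 2) * (h - θ) ^ 2 + (1 + 2 / δ) * (θ - t) ^ 2 := by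
    have : (1 + δ / 2) * (h - θ) ^ 2 + (1 + 2 / δ) * (θ - t) ^ 2 - (h - t) ^ 2 =
      (2 * δ)⁻¹ * (δ * (h - θ) - 2 * (θ - t)) ^ 2 := by field_simp; ring
    have h2 : 0 ≤ (2 * δ)⁻¹ * (δ * (h - θ) - 2 * (θ - t)) ^ 2 := by positivity
    linarith
  have h3 : (1 + δ)⁻¹ * (h - t) ^ 2 ≤
      (1 + δ)⁻¹ * ((1 + δ / 2) * (h - θ) ^ 2 + (1 + 2 / δ) * (θ - t) ^ 2) := by gcongr
  have h4 : δ / (2 * (1 + δ)) * (h - θ) ^ 2 = (h - θ) ^ 2 -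
      (1 + δ)⁻¹ * ((1 + δ / 2) * (h - θ) ^ 2) := by field_simp; ring
  have h5 : (1 + (1 + 2 / δ) / (1 + δ)) * (θ - t) ^ 2 = (θ - t) ^ 2 +
      (1 + δ)⁻¹ * ((1 + 2 / δ) * (θ - t) ^ 2) := by field_simp
  rw [h4, h5]
  nlinarith

lemma aux_entry0 (δ θ z : ℝ) (hδ : 0 < δ) :
    δ / (2 * (1 + δ)) * (0 - θ) ^ 2 ≤
      (θ + z - 0) ^ 2 - (θ + z - 0) ^ 2 + (1 + (1 + 2 / δ) / (1 + δ)) * (θ - 0) ^ 2 := by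
  have h1 : δ / (2 * (1 + δ)) ≤ 1 := by
    rw [div_le_one (by positivity)]; linarith
  have h2 : 0 ≤ (1 + 2 / δ) / (1 + δ) := by positivity
  nlinarith [sq_nonneg θ]

lemma aux_basic (δ : ℝ) (hδ : 0 < δ) {p r : ℕ} (Th H T : Matrix (Fin p) (Fin r) ℝ)
    (z : Fin p → Fin r → ℝ) (S : Finset (Fin p)) (hT : ∀ j, j ∉ S → T j = 0) :
    δ / (2 * (1 + δ)) * frobSq (H - Th) ≤
      frobSq (Th + Matrix.of z - H) - frobSq (Th + Matrix.of z - T) +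
      (1 + (1 + 2 / δ) / (1 + δ)) * frobSq (Th - T) +
      (1 + δ) * (∑ j ∈ suppF H, rowSq z j + ∑ j ∈ S, rowSq z j) := by
  classical
  have hA : ∀ B : Finset (Fin p), ∑ j ∈ B, rowSq z j =
      ∑ j, ∑ k, (if j ∈ B then (z j k) ^ 2 else 0) := by
    intro B
    rw [← Finset.sum_filter_add_sum_filter_not Finset.univ (fun j => j ∈ B)]
    rw [Finset.sum_eq_zero (s := Finset.univ.filter (fun j => ¬ j ∈ B)), add_zero]
    · apply Finset.sum_congr (Finset.filter_univ_mem B).symm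
      intro j hj
      have hj' : j ∈ B := (Finset.mem_filter.1 hj).2
      simp [rowSq, hj']
    · intro j hj
      simp only [Finset.mem_filter, Finset.mem_univ, true_and] at hj
      simp [hj]
  rw [hA, hA]
  unfold frobSq
  simp only [Finset.mul_sum, ← Finset.sum_add_distrib, ← Finset.sum_sub_distrib]
  apply Finset.sum_le_sum
  intro j _
  apply Finset.sum_le_sum
  intro k _
  simp only [Matrix.sub_apply, Matrix.add_apply, Matrix.of_apply]
  have hz : 0 ≤ (1 + δ) * z j k ^ 2 := by positivity
  have he := aux_entry δ (H j k) (T j k) (Th j k) (z j k) hδ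
  by_cases h1 : j ∈ suppF H
  · by_cases h2 : j ∈ S
    · simp only [h1, h2, if_true]
      linarith
    · simp only [h1, h2, if_true, if_false]
      linarith
  · by_cases h2 : j ∈ S
    · simp only [h1, h2, if_true, if_false]
      linarith
    · simp only [h1, h2, if_false]
      simp only [suppF, Finset.mem_filter, Finset.mem_univ, true_and, not_not] at h1
      rw [hT j h2, h1]
      have := aux_entry0 δ (Th j k) (z j k) hδ
      simp only [Pi.zero_apply]
      linarith

lemma aux_oracle (β δ : ℝ) (hβ : 2 < β) (hδ : 0 < δ) {p r : ℕ} (Th : Matrix (Fin p) (Fin r) ℝ)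
    (z : Fin p → Fin r → ℝ) (S : Finset (Fin p)) (k : ℕ) (hS : S.card ≤ k) (hkp : k ≤ p) :
    δ / (2 * (1 + δ)) * frobSq (penEst β δ (Th + Matrix.of z) - Th) ≤
      (1 + (1 + 2 / δ) / (1 + δ)) * frobSq (Th - restr Th S) +
      ((1 + δ) ^ 2 + (1 + δ)) * ∑ i ∈ Finset.Icc 1 k, tpen β p r i +
      2 * (1 + δ) * Rk β z := by
  have h1 := aux_basic δ hδ Th (penEst β δ (Th + Matrix.of z)) (restr Th S) z S
    (by intro j hj; ext k; simp [restr, hj])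
  have h2 := penEst_spec β δ hβ (Th + Matrix.of z) (restr Th S)
  set H := penEst β δ (Th + Matrix.of z)
  have h3 := Rk_bound β hβ z (suppF H)
  have h4 := Rk_bound β hβ z S
  have h5 := pen_mono β δ hβ p r _ _ ((suppCard_restr Th S).trans hS) hkp
  have mono : ∀ m n : ℕ, m ≤ n → n ≤ p → ∑ i ∈ Finset.Icc 1 m, tpen β p r i ≤
      ∑ i ∈ Finset.Icc 1 n, tpen β p r i := by
    intro m n hmn hn
    apply Finset.sum_le_sum_of_subset_of_nonneg (Finset.Icc_subset_Icc_right hmn)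
    intro i hi _
    rw [Finset.mem_Icc] at hi
    exact tpen_nonneg β hβ p r i hi.1 (hi.2.trans hn)
  have h6 := mono _ _ hS hkp
  have h7 := mono 0 (suppF H).card (Nat.zero_le _) (card_le_p _)
  rw [suppCard_eq H] at h2
  have h8 : pen β δ p r k = (1 + δ) ^ 2 * ∑ i ∈ Finset.Icc 1 k, tpen β p r i := rfl
  have h9 : pen β δ p r (suppF H).card =
    (1 + δ) ^ 2 * ∑ i ∈ Finset.Icc 1 (suppF H).card, tpen β p r i := rfl
  rw [h8] at h5
  rw [h9] at h2
  simp only [zero_lt_one, Finset.Icc_eq_empty_of_lt, Finset.sum_empty] at h7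
  have h10 : (1 + δ) * (∑ j ∈ suppF H, rowSq z j + ∑ j ∈ S, rowSq z j) ≤
      (1 + δ) * ((∑ i ∈ Finset.Icc 1 (suppF H).card, tpen β p r i + Rk β z) +
        (∑ i ∈ Finset.Icc 1 k, tpen β p r i + Rk β z)) := by
    gcongr
    linarith
  have h11 : 0 ≤ ((1 + δ) ^ 2 - (1 + δ)) * ∑ i ∈ Finset.Icc 1 (suppF H).card, tpen β p r i := by
    apply mul_nonneg _ h7
    nlinarith
  linarith

/-! ### Bias -/

lemma aux_tail_sum (a : ℝ) (ha : 1 < a) (k : ℕ) (hk : 0 < k) (n : ℕ) (hn : k ≤ n) :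
    ∑ j ∈ Finset.Ico k n, ((k : ℝ) / (j + 1 : ℕ)) ^ a ≤
      (k : ℝ) ^ a / (a - 1) * ((k : ℝ) ^ (1 - a) - (n : ℝ) ^ (1 - a)) := by
  induction n, hn using Nat.le_induction with
  | base => simp
  | succ n hn ih =>
    rw [Finset.sum_Ico_succ_top hn]
    have ha0 : 0 < a - 1 := by linarith
    have hn0 : (0 : ℝ) < n := by exact_mod_cast lt_of_lt_of_le hk hn
    set m : ℝ := ((n + 1 : ℕ) : ℝ) with hm
    have hmn : (n : ℝ) = m - 1 := by rw [hm]; push_cast; ring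
    have hm0 : 0 < m := by linarith
    have key : (a - 1) * m ^ (-a) ≤ (n : ℝ) ^ (1 - a) - m ^ (1 - a) := by
      have e1 : (n : ℝ) ^ (1 - a) = m ^ (1 - a) * ((n : ℝ) / m) ^ (1 - a) := by
        rw [Real.div_rpow hn0.le hm0.le]
        have := Real.rpow_pos_of_pos hm0 (1 - a)
        field_simp
      have e2 : 1 + (a - 1) / m ≤ ((n : ℝ) / m) ^ (1 - a) := by
        rw [Real.rpow_def_of_pos (by positivity)]
        have h1 : Real.log ((n : ℝ) / m) ≤ - 1 / m := by
          have := Real.log_le_sub_one_of_pos (show 0 < (n : ℝ) / m by positivity)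
          have e : (n : ℝ) / m - 1 = -1 / m := by rw [hmn]; field_simp; ring
          linarith
        have h2 := Real.add_one_le_exp (Real.log ((n : ℝ) / m) * (1 - a))
        have e3 : (a - 1) / m = (-1 / m) * (1 - a) := by ring
        nlinarith
      have e4 : m ^ (-a) = m ^ (1 - a) / m := by
        rw [← Real.rpow_sub_one hm0.ne']; congr 1; ring
      rw [e1, e4]
      have := mul_le_mul_of_nonneg_left e2 (Real.rpow_pos_of_pos hm0 (1 - a)).le
      have e5 : (a - 1) * (m ^ (1 - a) / m) = m ^ (1 - a) * ((a - 1) / m) := by ring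
      rw [e5]
      linarith
    have e6 : ((k : ℝ) / m) ^ a = (k : ℝ) ^ a * m ^ (-a) := by
      rw [Real.div_rpow (by positivity) hm0.le, Real.rpow_neg hm0.le]; rfl
    have e7 : (k : ℝ) ^ a * m ^ (-a) = (k : ℝ) ^ a / (a - 1) * ((a - 1) * m ^ (-a)) := by
      field_simp
    have e8 : (k : ℝ) ^ a / (a - 1) * ((a - 1) * m ^ (-a)) ≤
        (k : ℝ) ^ a / (a - 1) * ((n : ℝ) ^ (1 - a) - m ^ (1 - a)) := by gcongr
    rw [e6, e7]
    linarith

lemma aux_tail_sum' (a : ℝ) (ha : 1 < a) (k : ℕ) (hk : 0 < k) (n : ℕ) (hn : k ≤ n) :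
    ∑ j ∈ Finset.Ico k n, ((k : ℝ) / (j + 1 : ℕ)) ^ a ≤ k / (a - 1) := by
  refine (aux_tail_sum a ha k hk n hn).trans ?_
  have hk' : (0 : ℝ) < k := by exact_mod_cast hk
  have ha0 : 0 < a - 1 := by linarith
  have h1 : (k : ℝ) ^ a / (a - 1) * ((k : ℝ) ^ (1 - a)) = k / (a - 1) := by
    rw [div_mul_eq_mul_div, ← Real.rpow_add hk']
    simp
  have h2 : 0 ≤ (k : ℝ) ^ a / (a - 1) * (n : ℝ) ^ (1 - a) := by positivity
  linarith

lemma kprime_spec (q β s' : ℝ) (p r : ℕ) (hp : 0 < p) :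
    0 < kprime q β s' p r ∧ kprime q β s' p r ≤ p ∧
      (kprime q β s' p r = p ∨
        s' ≤ tpen β p r (kprime q β s' p r) ^ (q / 2) * (kprime q β s' p r : ℝ)) := by
  unfold kprime
  split_ifs with h
  · have := Nat.sInf_mem (s := {k : ℕ | 1 ≤ k ∧ k ≤ p ∧ s' ≤ tpen β p r k ^ (q / 2) * k}) h
    exact ⟨this.1, this.2.1, Or.inr this.2.2⟩
  · exact ⟨hp, le_rfl, Or.inl rfl⟩

/-- set of the `k` largest rows -/
def topS {p r : ℕ} (Th : Matrix (Fin p) (Fin r) ℝ) (k : ℕ) : Finset (Fin p) :=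
  (Finset.univ.filter (fun j : Fin p => j.val < k)).map
    (Tuple.sort (fun i => - rowNorm Th i)).toEmbedding

lemma topS_card {p r : ℕ} (Th : Matrix (Fin p) (Fin r) ℝ) (k : ℕ) : (topS Th k).card ≤ k := by
  unfold topS
  rw [Finset.card_map]
  have : (Finset.univ.filter (fun j : Fin p => j.val < k)).card =
      ((Finset.univ.filter (fun j : Fin p => j.val < k)).map Fin.valEmbedding).card := by
    rw [Finset.card_map]
  rw [this]
  calc _ ≤ (Finset.range k).card := by
        apply Finset.card_le_card
        intro x hx
        simp only [Finset.mem_map, Finset.mem_filter, Finset.mem_univ, true_and] at hx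
        obtain ⟨y, hy, rfl⟩ := hx
        simpa using hy
    _ = k := by simp

lemma bias_eq {p r : ℕ} (Th : Matrix (Fin p) (Fin r) ℝ) (k : ℕ) :
    frobSq (Th - restr Th (topS Th k)) =
      ∑ j : Fin p, if j.val < k then 0 else (sortedRowNorm Th j) ^ 2 := by
  unfold frobSq
  rw [← Equiv.sum_comp (Tuple.sort (fun i => - rowNorm Th i))]
  apply Finset.sum_congr rfl
  intro j _
  have hmem : (Tuple.sort (fun i => - rowNorm Th i)) j ∈ topS Th k ↔ j.val < k := by
    unfold topS
    rw [Finset.mem_map]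
    constructor
    · rintro ⟨a, ha, hab⟩
      have : a = j := (Tuple.sort (fun i => - rowNorm Th i)).injective hab
      subst this
      simpa using ha
    · intro h
      exact ⟨j, by simpa using h, rfl⟩
  split_ifs with h
  · apply Finset.sum_eq_zero
    intro l _
    simp [restr, hmem.2 h]
  · have h' := fun h2 => h (hmem.1 h2)
    have hs : sortedRowNorm Th j ^ 2 =
        ∑ l, (Th ((Tuple.sort (fun i => - rowNorm Th i)) j) l) ^ 2 :=
      Real.sq_sqrt (Finset.sum_nonneg (fun _ _ => sq_nonneg _))
    rw [hs]
    apply Finset.sum_congr rfl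
    intro l _
    simp only [Matrix.sub_apply, restr]
    rw [if_neg h', sub_zero]

lemma aux_bias (q β s' : ℝ) (hq0 : 0 ≤ q) (hq2 : q < 2) (hβ : 2 < β) (p r k : ℕ) (hk : 0 < k)
    (hkp : k ≤ p) (Th : Matrix (Fin p) (Fin r) ℝ) (hTh : weakLq q Th ≤ s')
    (h : k = p ∨ s' ≤ tpen β p r k ^ (q / 2) * (k : ℝ)) :
    frobSq (Th - restr Th (topS Th k)) ≤ q / (2 - q) * (k * tpen β p r k) := by
  rw [bias_eq]
  have ht := tpen_nonneg β hβ p r k hk hkp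
  have hk' : (0 : ℝ) < k := by exact_mod_cast hk
  have hq2' : 0 < 2 - q := by linarith
  rcases h with h | h
  · rw [Finset.sum_eq_zero]
    · positivity
    · intro j _
      rw [if_pos (by rw [h]; exact j.2)]
  have hw : ∀ j : Fin p, ((j : ℕ) + 1 : ℝ) *
    (if sortedRowNorm Th j = 0 then 0 else (sortedRowNorm Th j) ^ q) ≤
      tpen β p r k ^ (q / 2) * (k : ℝ) := by
    intro j
    refine le_trans ?_ (hTh.trans h)
    unfold weakLq
    exact le_ciSup (f := fun j : Fin p => ((j : ℕ) + 1 : ℝ) *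
      (if sortedRowNorm Th j = 0 then 0 else (sortedRowNorm Th j) ^ q))
      (Set.finite_range _).bddAbove j
  have hs0 : ∀ j : Fin p, 0 ≤ sortedRowNorm Th j := fun j => Real.sqrt_nonneg _
  rcases hq0.eq_or_lt with hq | hq
  · subst hq
    rw [Finset.sum_eq_zero]
    · positivity
    · intro j _
      split_ifs with hjk
      · rfl
      · have h1 := hw j
        by_cases hz : sortedRowNorm Th j = 0
        · simp [hz]
        · exfalso
          rw [if_neg hz] at h1
          simp only [Real.rpow_zero, zero_div, mul_one, one_mul] at h1
          have : (j : ℕ) + 1 ≤ k := by exact_mod_cast h1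
          omega
  · have hterm : ∀ j : Fin p, (if j.val < k then 0 else (sortedRowNorm Th j) ^ 2) ≤
        (fun j : ℕ => if j < k then 0 else
          tpen β p r k * ((k : ℝ) / (j + 1 : ℕ)) ^ (2 / q)) j.val := by
      intro j
      dsimp only
      split_ifs with hjk
      · exact le_rfl
      · by_cases hz : sortedRowNorm Th j = 0
        · rw [hz]
          simp only [ne_eq, OfNat.ofNat_ne_zero, not_false_eq_true, zero_pow]
          positivity
        · have h1 := hw j
          rw [if_neg hz] at h1
          have hj : (0 : ℝ) < (j : ℕ) + 1 := by positivity
          have h2 : sortedRowNorm Th j ^ q ≤ tpen β p r k ^ (q / 2) * (k / ((j : ℕ) + 1 : ℕ)) := by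
            push_cast
            rw [← mul_div_assoc, le_div_iff₀ hj]
            linarith
          have h3 := Real.rpow_le_rpow (by have := hs0 j; positivity) h2
            (show 0 ≤ 2 / q by positivity)
          rw [← Real.rpow_mul (hs0 j), Real.mul_rpow (by positivity) (by positivity),
            ← Real.rpow_mul ht] at h3
          have e1 : q * (2 / q) = 2 := by field_simp
          have e2 : q / 2 * (2 / q) = 1 := by field_simp
          rw [e1, e2, Real.rpow_one, Real.rpow_two] at h3
          exact h3
    refine (Finset.sum_le_sum (fun j _ => hterm j)).trans ?_
    rw [Fin.sum_univ_eq_sum_range (fun j : ℕ => if j < k then 0 else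
          tpen β p r k * ((k : ℝ) / (j + 1 : ℕ)) ^ (2 / q)) p]
    have hsplit : ∑ j ∈ Finset.range p, (if j < k then 0 else
          tpen β p r k * ((k : ℝ) / (j + 1 : ℕ)) ^ (2 / q)) =
        ∑ j ∈ Finset.Ico k p, tpen β p r k * ((k : ℝ) / (j + 1 : ℕ)) ^ (2 / q) := by
      rw [← Finset.sum_range_add_sum_Ico _ hkp]
      rw [Finset.sum_eq_zero (s := Finset.range k), zero_add]
      · apply Finset.sum_congr rfl
        intro j hj
        rw [if_neg (by have := (Finset.mem_Ico.1 hj).1; omega)]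
      · intro j hj
        rw [if_pos (Finset.mem_range.1 hj)]
    rw [hsplit, ← Finset.mul_sum]
    have ha : 1 < 2 / q := by rw [lt_div_iff₀ hq]; linarith
    have h5 := aux_tail_sum' (2 / q) ha k hk p hkp
    calc _ ≤ tpen β p r k * (k / (2 / q - 1)) := by gcongr
      _ = _ := by
        have : 2 / q - 1 = (2 - q) / q := by field_simp
        rw [this]
        field_simp

/-- Uniform risk bound for a single parameter. -/
lemma aux_main (q : ℝ) (hq0 : 0 ≤ q) (hq2 : q < 2) (β : ℝ) (hβ : 2 < β) (δ : ℝ) (hδ0 : 0 < δ)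
    (p r : ℕ) (hp : 0 < p) (hr : 0 < r) (s' : ℝ)
    (Th : Matrix (Fin p) (Fin r) ℝ) (hTh : weakLq q Th ≤ s') :
    δ / (2 * (1 + δ)) * ∫ z, frobSq (penEst β δ (Th + Matrix.of z) - Th) ∂ gaussianMatrix p r ≤
      ((1 + (1 + 2 / δ) / (1 + δ)) * (q / (2 - q)) * (2 * β) +
        ((1 + δ) ^ 2 + (1 + δ)) * (4 * β) +
        2 * (1 + δ) * (2 * (1 - Real.exp (-(β / 2 - 1)))⁻¹)) *
      ((kprime q β s' p r : ℝ) * (r + Lk p (kprime q β s' p r))) := by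
  obtain ⟨hk, hkp, hks⟩ := kprime_spec q β s' p r hp
  set k := kprime q β s' p r
  have hk1 : (1 : ℝ) ≤ k := by exact_mod_cast hk
  have hr0 : (0 : ℝ) ≤ r := Nat.cast_nonneg r
  have hL := Lk_ge p k hk hkp
  have hq2' : 0 < 2 - q := by linarith
  have hbias := aux_bias q β s' hq0 hq2 hβ p r k hk hkp Th hTh hks
  have htp := tpen_le β hβ p r k hk hkp
  have hst := aux_sum_tpen β hβ p r k hk hkp
  have hRi := Rk_integral β hβ (p := p) hr
  set Q := (k : ℝ) * (r + Lk p k) with hQ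
  have ha1 : 0 < (1 - Real.exp (-(β / 2 - 1)))⁻¹ := by
    apply inv_pos.2
    have : Real.exp (-(β / 2 - 1)) < 1 := by rw [Real.exp_lt_one_iff]; linarith
    linarith
  set a := (1 - Real.exp (-(β / 2 - 1)))⁻¹
  have hrQ : 2 + (r : ℝ) ≤ 2 * Q := by rw [hQ]; nlinarith
  have hb : frobSq (Th - restr Th (topS Th k)) ≤ q / (2 - q) * (2 * β) * Q := by
    refine hbias.trans ?_
    calc q / (2 - q) * (k * tpen β p r k) ≤ q / (2 - q) * (k * (2 * β * (r + Lk p k))) := by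
          gcongr
      _ = _ := by rw [hQ]; ring
  rw [← integral_const_mul]
  set c0 := (1 + (1 + 2 / δ) / (1 + δ)) * frobSq (Th - restr Th (topS Th k)) +
      ((1 + δ) ^ 2 + (1 + δ)) * ∑ i ∈ Finset.Icc 1 k, tpen β p r i with hc0
  have h1 : ∫ z, δ / (2 * (1 + δ)) * frobSq (penEst β δ (Th + Matrix.of z) - Th)
      ∂ gaussianMatrix p r ≤ ∫ z, (c0 + 2 * (1 + δ) * Rk β z) ∂ gaussianMatrix p r := by
    apply integral_mono_of_nonneg
    · filter_upwards with z
      simp only [Pi.zero_apply]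
      unfold frobSq
      positivity
    · exact (integrable_const _).add ((Rk_integrable β hβ hr).const_mul _)
    · filter_upwards with z
      exact aux_oracle β δ hβ hδ0 Th z (topS Th k) k (topS_card Th k) hkp
  refine h1.trans ?_
  rw [integral_add (integrable_const _) ((Rk_integrable β hβ hr).const_mul _),
    integral_const_mul]
  simp only [integral_const, probReal_univ, one_smul]
  have h2 : c0 ≤ (1 + (1 + 2 / δ) / (1 + δ)) * (q / (2 - q) * (2 * β) * Q) +
      ((1 + δ) ^ 2 + (1 + δ)) * (4 * β * Q) := by
    rw [hc0]; gcongr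
  have h3 : 2 * (1 + δ) * ∫ z, Rk β (p := p) (r := r) z ∂ gaussianMatrix p r ≤
      2 * (1 + δ) * (2 * Q * a) := by
    gcongr
    exact hRi.trans (by gcongr)
  linarith

/-- **Theorem 6** (orthogonal-design multivariate regression with group
sparsity): the penalized least-squares estimator is rate optimal over the
weak-`ℓ_q` ball `F_q(s',p)`. -/
theorem regression_group_sparsity_upper_bound (q : ℝ) (hq0 : 0 ≤ q)
    (hq2 : q < 2) (β : ℝ) (hβ : 2 < β) (δ : ℝ) (hδ0 : 0 < δ) (hδ1 : δ < 1) :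
    ∃ C : ℝ, 0 < C ∧
      ∀ (p r : ℕ) (s' : ℝ), 0 < s' →
        (⨆ (Θ₀ : Matrix (Fin p) (Fin r) ℝ) (_ : weakLq q Θ₀ ≤ s'),
            ∫ z, frobSq (penEst β δ (Θ₀ + Matrix.of z) - Θ₀)
              ∂ gaussianMatrix p r)
          ≤ C * (kprime q β s' p r : ℝ) *
              ((r : ℝ) + Real.log (Real.exp 1 * p / (kprime q β s' p r : ℝ))) := by
  set K := ((1 + (1 + 2 / δ) / (1 + δ)) * (q / (2 - q)) * (2 * β) +
        ((1 + δ) ^ 2 + (1 + δ)) * (4 * β) +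
        2 * (1 + δ) * (2 * (1 - Real.exp (-(β / 2 - 1)))⁻¹)) with hK
  have hq2' : 0 < 2 - q := by linarith
  have ha1 : 0 < (1 - Real.exp (-(β / 2 - 1)))⁻¹ := by
    apply inv_pos.2
    have : Real.exp (-(β / 2 - 1)) < 1 := by rw [Real.exp_lt_one_iff]; linarith
    linarith
  have hK0 : 0 < K := by rw [hK]; positivity
  refine ⟨(δ / (2 * (1 + δ)))⁻¹ * K, by positivity, ?_⟩
  intro p r s' _
  have hRHS : 0 ≤ (δ / (2 * (1 + δ)))⁻¹ * K * (kprime q β s' p r : ℝ) *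
      ((r : ℝ) + Real.log (Real.exp 1 * p / (kprime q β s' p r : ℝ))) := by
    rcases Nat.eq_zero_or_pos p with hp | hp
    · subst hp
      have : kprime q β s' 0 r = 0 := by
        unfold kprime
        rw [if_neg]
        rintro ⟨k, h1, h2, -⟩
        omega
      simp [this]
    · obtain ⟨hk, hkp, -⟩ := kprime_spec q β s' p r hp
      have := Lk_ge p _ hk hkp
      unfold Lk at this
      positivity
  refine Real.iSup_le (fun Th => Real.iSup_le (fun hTh => ?_) hRHS) hRHS
  rcases Nat.eq_zero_or_pos p with hp | hp
  · subst hp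
    simpa [frobSq] using hRHS
  rcases Nat.eq_zero_or_pos r with hr | hr
  · subst hr
    simpa [frobSq] using hRHS
  have h := aux_main q hq0 hq2 β hβ δ hδ0 p r hp hr s' Th hTh
  rw [← hK] at h
  have h2 := mul_le_mul_of_nonneg_left h (show 0 ≤ (δ / (2 * (1 + δ)))⁻¹ by positivity)
  rw [← mul_assoc, inv_mul_cancel₀ (by positivity), one_mul] at h2
  refine h2.trans (le_of_eq ?_)
  unfold Lk
  ring

end SparsePCA
end
end
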